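/- arXiv:0907.0620 — 9 statements merged into one kernel-verified Lean document; each statement's English description precedes it below -/
import Mathlib

section
/- Let U = (U_i)_{i≥0} be a positional numeration system satisfying lim_{i→∞}(U_{i+1} − U_i) = +∞. Then for every j ≥ 0 there exists L such that for all ℓ ≥ L and all t ∈ {0, …, U_j − 1}, the word 1·0^{ℓ−|rep_U(t)|}·rep_U(t) is a greedy U-representation (namely of U_ℓ + t). Equivalently: if w is a greedy U-representation, then for all sufficiently large r the word 1·0^r·w is also a greedy U-representation. -/
open Filter

/-- `C_U = sup_{i ≥ 0} ⌈U_{i+1} / U_i⌉` (with the ceiling of the quotient of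
naturals written as `(U (i+1) + U i - 1) / U i`). -/
noncomputable def CU (U : ℕ → ℕ) : ℕ :=
  sSup {c : ℕ | ∃ i, c = (U (i + 1) + U i - 1) / U i}

/-- The `U`-numerical value of the word `w = w_ℓ ⋯ w_0` (most significant digit
first): `val_U(w) = Σ_{i=0}^{ℓ} w_i U_i`. -/
def valU (U : ℕ → ℕ) (w : List ℕ) : ℕ :=
  ∑ i ∈ Finset.range w.length, w.reverse.getD i 0 * U i

/-- `w` is the greedy `U`-representation of `n` (most significant digit first):
its digits lie in `A_U = {0, …, C_U - 1}`, its leading digit is nonzero, its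
`U`-numerical value is `n`, and `Σ_{i=0}^{t} w_i U_i < U_{t+1}` for all
`t = 0, …, ℓ`.  In particular `IsGreedyRep U 0 []`. -/
def IsGreedyRep (U : ℕ → ℕ) (n : ℕ) (w : List ℕ) : Prop :=
  valU U w = n ∧
  (∀ d ∈ w, d < CU U) ∧
  (∀ h : w ≠ [], w.head h ≠ 0) ∧
  ∀ t < w.length, ∑ i ∈ Finset.range (t + 1), w.reverse.getD i 0 * U i < U (t + 1)

lemma two_le_CU (U : ℕ → ℕ) (hmono : StrictMono U) (h0 : U 0 = 1)
    (hfin : ∃ C, ∀ i, U (i + 1) ≤ C * U i) : 2 ≤ CU U := by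
  obtain ⟨C, hC⟩ := hfin
  have h1 : U 0 < U 1 := hmono (by norm_num)
  have hb : BddAbove {c : ℕ | ∃ i, c = (U (i + 1) + U i - 1) / U i} := by
    refine ⟨C + 1, ?_⟩
    rintro c ⟨i, rfl⟩
    have := hC i
    apply Nat.div_le_of_le_mul
    have e : U i * (C + 1) = C * U i + U i := by ring
    omega
  have h2 : U 1 ≤ CU U := by
    apply le_csSup hb
    refine ⟨0, ?_⟩
    simp [h0]
  omega

/-- Digits of the extended word. -/
lemma digit_ext (w : List ℕ) (r i : ℕ) :
    (1 :: (List.replicate r 0 ++ w)).reverse.getD i 0 =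
      if i < w.length then w.reverse.getD i 0 else if i = r + w.length then 1 else 0 := by
  have e : (1 :: (List.replicate r 0 ++ w)).reverse = w.reverse ++ (List.replicate r 0 ++ [1]) := by
    simp
  rw [e]
  split_ifs with h1 h2
  · rw [List.getD_append _ _ _ _ (by simpa using h1)]
  · rw [List.getD_append_right _ _ _ _ (by simpa using h1),
      List.getD_append_right _ _ _ _ (by simp; omega)]
    simp [h2]
  · rw [List.getD_append_right _ _ _ _ (by simpa using h1)]
    rcases lt_or_ge (i - w.length) r with h3 | h3
    · rw [List.getD_append _ _ _ _ (by simpa using h3)]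
      simp [List.getD_eq_getElem?_getD, List.getElem?_replicate, h3]
    · apply List.getD_eq_default
      simp
      omega

lemma sum_ext (U : ℕ → ℕ) (w : List ℕ) (r s : ℕ) (hs : s ≤ r) :
    ∑ i ∈ Finset.range (w.length + s),
      (1 :: (List.replicate r 0 ++ w)).reverse.getD i 0 * U i = valU U w := by
  rw [Finset.sum_range_add, valU]
  have h2 : ∑ x ∈ Finset.range s, (1 :: (List.replicate r 0 ++ w)).reverse.getD (w.length + x) 0
      * U (w.length + x) = 0 := by
    apply Finset.sum_eq_zero
    intro x hx
    rw [Finset.mem_range] at hx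
    rw [digit_ext, if_neg (by omega), if_neg (by omega), zero_mul]
  rw [h2, add_zero]
  apply Finset.sum_congr rfl
  intro x hx
  rw [Finset.mem_range] at hx
  rw [digit_ext, if_pos hx]

lemma greedy_ext (U : ℕ → ℕ) (hmono : StrictMono U) (h0 : U 0 = 1)
    (hC : 2 ≤ CU U) (t r : ℕ) (w : List ℕ) (hw : IsGreedyRep U t w)
    (hlt : U (r + w.length) + t < U (r + w.length + 1)) :
    IsGreedyRep U (U (r + w.length) + t) (1 :: (List.replicate r 0 ++ w)) := by
  obtain ⟨hv, hd, hh, hg⟩ := hw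
  have hfull : ∑ i ∈ Finset.range (r + w.length + 1),
      (1 :: (List.replicate r 0 ++ w)).reverse.getD i 0 * U i = U (r + w.length) + t := by
    rw [Finset.sum_range_succ, digit_ext, if_neg (by omega), if_pos rfl, add_comm r,
      sum_ext U w r r le_rfl, hv]
    ring
  have htk : t < U w.length := by
    rcases Nat.eq_zero_or_pos w.length with hk | hk
    · rw [valU, hk] at hv
      simp at hv
      rw [hk, h0]
      omega
    · have := hg (w.length - 1) (by omega)
      rw [Nat.sub_add_cancel hk] at this
      rw [← hv]
      exact this
  have hlen : (1 :: (List.replicate r 0 ++ w)).length = r + w.length + 1 := by simp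
  refine ⟨?_, ?_, ?_, ?_⟩
  · rw [valU, hlen]
    exact hfull
  · intro d hdm
    simp only [List.mem_cons, List.mem_append, List.mem_replicate] at hdm
    rcases hdm with h | h | h
    · omega
    · omega
    · exact hd d h
  · intro _
    simp
  · intro s hs
    rw [hlen] at hs
    rcases lt_or_ge s w.length with h1 | h1
    · refine lt_of_eq_of_lt (Finset.sum_congr rfl ?_) (hg s h1)
      intro x hx
      rw [Finset.mem_range] at hx
      rw [digit_ext, if_pos (by omega)]
    · rcases eq_or_ne s (r + w.length) with h2 | h2
      · rw [h2, hfull]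
        exact hlt
      · obtain ⟨q, hq⟩ := Nat.exists_eq_add_of_le h1
        have e : s + 1 = w.length + (q + 1) := by omega
        rw [e, sum_ext U w r (q + 1) (by omega), hv]
        exact htk.trans (hmono (by omega))

lemma length_le (U : ℕ → ℕ) (hmono : StrictMono U) (t j : ℕ) (ht : t < U j)
    (w : List ℕ) (hw : IsGreedyRep U t w) : w.length ≤ j := by
  obtain ⟨hv, hd, hh, hg⟩ := hw
  cases w with
  | nil => simp
  | cons a v =>
    have ha : a ≠ 0 := by simpa using hh (by simp)
    have e : (a :: v).reverse.getD v.length 0 = a := by simp [List.getD_eq_getElem?_getD]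
    have h1 : U v.length ≤ t := by
      rw [← hv, valU, List.length_cons, Finset.sum_range_succ, e]
      have : 1 * U v.length ≤ a * U v.length := Nat.mul_le_mul_right _ (by omega)
      omega
    have := hmono.lt_iff_lt.1 (h1.trans_lt ht)
    simp
    omega

/-- Let `U` be a positional numeration system with
`lim_{i → ∞} (U_{i+1} - U_i) = +∞`.  Then for every `j` there exists `L` such
that for all `ℓ ≥ L` and all `t < U_j`, the word `1·0^{ℓ - |rep_U(t)|}·rep_U(t)`
is a greedy `U`-representation (namely of `U_ℓ + t`).  Equivalently, if `w` is a
greedy `U`-representation, then for all sufficiently large `r` the word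
`1·0^r·w` is also a greedy `U`-representation. -/
theorem statement_0 (U : ℕ → ℕ) (hmono : StrictMono U) (h0 : U 0 = 1)
    (hfin : ∃ C, ∀ i, U (i + 1) ≤ C * U i)
    (hlim : Tendsto (fun i => U (i + 1) - U i) atTop atTop) :
    (∀ j : ℕ, ∃ L : ℕ, ∀ ℓ, L ≤ ℓ → ∀ t, t < U j → ∀ w : List ℕ,
        IsGreedyRep U t w →
        IsGreedyRep U (U ℓ + t) (1 :: (List.replicate (ℓ - w.length) 0 ++ w))) ∧
    (∀ n : ℕ, ∀ w : List ℕ, IsGreedyRep U n w → ∃ R : ℕ, ∀ r, R ≤ r →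
        ∃ m : ℕ, IsGreedyRep U m (1 :: (List.replicate r 0 ++ w))) := by
  have hC := two_le_CU U hmono h0 hfin
  have key : ∀ n, ∃ N, ∀ i, N ≤ i → U i + n < U (i + 1) := by
    intro n
    obtain ⟨N, hN⟩ := Filter.eventually_atTop.1 (hlim.eventually_ge_atTop (n + 1))
    refine ⟨N, fun i hi => ?_⟩
    have := hN i hi
    omega
  constructor
  · intro j
    obtain ⟨N, hN⟩ := key (U j)
    refine ⟨max j N, fun l hl t ht w hw => ?_⟩
    have hk := length_le U hmono t j ht w hw
    have hjl : j ≤ l := le_trans (le_max_left _ _) hl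
    have e : l - w.length + w.length = l := by omega
    have h := greedy_ext U hmono h0 hC t (l - w.length) w hw
    rw [e] at h
    apply h
    have := hN l (le_trans (le_max_right _ _) hl)
    omega
  · intro n w hw
    obtain ⟨N, hN⟩ := key n
    exact ⟨N, fun r hr => ⟨_, greedy_ext U hmono h0 hC n r w hw (hN _ (by omega))⟩⟩
end

section
/- Let X ⊆ ℕ be an ultimately periodic set with minimal period p_X and minimal preperiod a_X. For all i, j ≥ a_X, if i ≢ j (mod p_X) then there exists t < p_X such that either i + t ∈ X and j + t ∉ X, or i + t ∉ X and j + t ∈ X. -/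
/-- `X` is periodic with period `p` from index `a` on: for all `n ≥ a`,
`n ∈ X ↔ n + p ∈ X`. -/
def IsPeriodPair (X : Set ℕ) (a p : ℕ) : Prop :=
  0 < p ∧ ∀ n, a ≤ n → (n ∈ X ↔ n + p ∈ X)

/-- `X` is ultimately periodic. -/
def UltPeriodic (X : Set ℕ) : Prop := ∃ a p, IsPeriodPair X a p

/-- The minimal period `p_X` of an ultimately periodic set. -/
noncomputable def minPeriod (X : Set ℕ) : ℕ := sInf {p | ∃ a, IsPeriodPair X a p}

/-- The minimal preperiod `a_X` of an ultimately periodic set (relative to the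
minimal period). -/
noncomputable def minPreperiod (X : Set ℕ) : ℕ :=
  sInf {a | IsPeriodPair X a (minPeriod X)}

theorem aux_mul (X : Set ℕ) (a p : ℕ) (h : IsPeriodPair X a p) (k n : ℕ) (hn : a ≤ n) :
    n ∈ X ↔ n + p * k ∈ X := by
  induction k with
  | zero => simp
  | succ k ih =>
    rw [ih, h.2 (n + p * k) (by omega), Nat.mul_succ, Nat.add_assoc]

theorem aux_lt (X : Set ℕ) (a p i j : ℕ) (h : IsPeriodPair X a p)
    (hmin : ∀ b q, IsPeriodPair X b q → p ≤ q)
    (hi : a ≤ i) (hlt : i ≤ j) (hij : ¬ i ≡ j [MOD p])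
    (hall : ∀ t < p, (i + t ∈ X ↔ j + t ∈ X)) : False := by
  have hp := h.1
  have hall' : ∀ t, (i + t ∈ X ↔ j + t ∈ X) := by
    intro t
    have e := Nat.mod_add_div t p
    have h1 := aux_mul X a p h (t / p) (i + t % p) (by omega)
    have h2 := aux_mul X a p h (t / p) (j + t % p) (by omega)
    rw [Nat.add_assoc, e] at h1 h2
    rw [← h1, ← h2]
    exact hall _ (Nat.mod_lt _ hp)
  have hr : 0 < (j - i) % p := by
    rcases Nat.eq_zero_or_pos ((j - i) % p) with h0 | h0
    · exact absurd ((Nat.modEq_iff_dvd' hlt).2 (Nat.dvd_of_mod_eq_zero h0)) hij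
    · exact h0
  have := hmin i ((j - i) % p) ⟨hr, fun n hn => by
    have e := Nat.mod_add_div (j - i) p
    have h1 := aux_mul X a p h ((j - i) / p) (n + (j - i) % p) (by omega)
    rw [Nat.add_assoc, e] at h1
    rw [h1]
    have h2 := hall' (n - i)
    rwa [show i + (n - i) = n by omega, show j + (n - i) = n + (j - i) by omega] at h2⟩
  have := Nat.mod_lt (j - i) hp
  omega

/-- Let `X ⊆ ℕ` be an ultimately periodic set with minimal period `p_X` and minimal
preperiod `a_X`.  For all `i, j ≥ a_X`, if `i ≢ j (mod p_X)` then there exists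
`t < p_X` such that either `i + t ∈ X` and `j + t ∉ X`, or `i + t ∉ X` and
`j + t ∈ X`. -/
theorem statement_1 (X : Set ℕ) (hX : UltPeriodic X) (i j : ℕ)
    (hi : minPreperiod X ≤ i) (hj : minPreperiod X ≤ j)
    (hij : ¬ i ≡ j [MOD minPeriod X]) :
    ∃ t < minPeriod X,
      (i + t ∈ X ∧ j + t ∉ X) ∨ (i + t ∉ X ∧ j + t ∈ X) := by
  obtain ⟨a₀, p₀, h₀⟩ := hX
  have h1 : ∃ a, IsPeriodPair X a (minPeriod X) :=
    Nat.sInf_mem (s := {p | ∃ a, IsPeriodPair X a p}) ⟨p₀, a₀, h₀⟩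
  have h2 : IsPeriodPair X (minPreperiod X) (minPeriod X) :=
    Nat.sInf_mem (s := {a | IsPeriodPair X a (minPeriod X)}) h1
  have hmin : ∀ b q, IsPeriodPair X b q → minPeriod X ≤ q := fun b q hq =>
    Nat.sInf_le ⟨b, hq⟩
  by_contra hcon
  have hall : ∀ t < minPeriod X, (i + t ∈ X ↔ j + t ∈ X) := by
    intro t ht
    by_contra hne
    exact hcon ⟨t, ht, by tauto⟩
  rcases le_total i j with hle | hle
  · exact aux_lt X _ _ i j h2 hmin hi hle hij hall
  · exact aux_lt X _ _ j i h2 hmin hj hle (fun h => hij h.symm) (fun t ht => (hall t ht).symm)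
end

section
/- Let U = (U_i)_{i≥0} be a positional numeration system satisfying lim_{i→∞}(U_{i+1} − U_i) = +∞. If X ⊆ ℕ is an ultimately periodic U-recognizable set with minimal period p_X, then every deterministic finite automaton over A_U whose accepted language is rep_U(X) := {rep_U(n) : n ∈ X} has at least N_U(p_X) states. -/
open Filter

/-- The language `rep_U(X)` of greedy `U`-representations of the elements of `X`. -/
def repLang (U : ℕ → ℕ) (X : Set ℕ) : Language ℕ :=
  {w | ∃ n ∈ X, IsGreedyRep U n w}

/-- `N_U(m)`: the number of residues mod `m` taken infinitely often by the
sequence `(U_i mod m)_{i ≥ 0}`. -/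
noncomputable def Ninf (s : ℕ → ℕ) (m : ℕ) : ℕ :=
  Set.ncard {r : ZMod m | ∀ N : ℕ, ∃ i, N ≤ i ∧ (s i : ZMod m) = r}

def grd (U : ℕ → ℕ) : ℕ → ℕ → List ℕ
  | 0, _ => []
  | L + 1, k => (k / U L) :: grd U L (k % U L)

lemma grd_length (U : ℕ → ℕ) (L k : ℕ) : (grd U L k).length = L := by
  induction L generalizing k with
  | zero => rfl
  | succ L ih => simp [grd, ih]

lemma psum_cons (U : ℕ → ℕ) (d : ℕ) (w : List ℕ) (t : ℕ) (ht : t ≤ w.length) :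
    ∑ i ∈ Finset.range t, (d :: w).reverse.getD i 0 * U i
      = ∑ i ∈ Finset.range t, w.reverse.getD i 0 * U i := by
  apply Finset.sum_congr rfl
  intro i hi
  rw [Finset.mem_range] at hi
  rw [List.reverse_cons, List.getD_append _ _ _ _ (by simp; omega)]

lemma valU_cons (U : ℕ → ℕ) (d : ℕ) (w : List ℕ) :
    valU U (d :: w) = d * U w.length + valU U w := by
  unfold valU
  rw [List.length_cons, Finset.sum_range_succ, psum_cons U d w _ le_rfl, add_comm]
  congr 2
  rw [List.reverse_cons, List.getD_append_right _ _ _ _ (by simp)]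
  simp

lemma grd_val (U : ℕ → ℕ) (h0 : U 0 = 1) (hmono : StrictMono U) (L k : ℕ) (hk : k < U L) :
    valU U (grd U L k) = k := by
  induction L generalizing k with
  | zero =>
    rw [h0] at hk
    simp [grd, valU]; omega
  | succ L ih =>
    have hpos : 0 < U L := by
      have := hmono.monotone (Nat.zero_le L); omega
    rw [grd, valU_cons, grd_length, ih _ (Nat.mod_lt _ hpos)]
    exact Nat.div_add_mod' k (U L)

lemma grd_greedy (U : ℕ → ℕ) (h0 : U 0 = 1) (hmono : StrictMono U) (L k : ℕ) (hk : k < U L) :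
    ∀ t < L, ∑ i ∈ Finset.range (t + 1), (grd U L k).reverse.getD i 0 * U i < U (t + 1) := by
  induction L generalizing k with
  | zero => intro t ht; omega
  | succ L ih =>
    intro t ht
    have hpos : 0 < U L := by
      have := hmono.monotone (Nat.zero_le L); omega
    rcases Nat.lt_succ_iff_lt_or_eq.mp ht with h | h
    · rw [grd, psum_cons _ _ _ _ (by rw [grd_length]; omega)]
      exact ih _ (Nat.mod_lt _ hpos) t h
    · subst h
      have := grd_val U h0 hmono (t + 1) k hk
      unfold valU at this
      rw [grd_length] at this
      rw [this]; exact hk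

lemma div_lt_CU (U : ℕ → ℕ) (h0 : U 0 = 1) (hmono : StrictMono U)
    (hfin : ∃ C, ∀ i, U (i + 1) ≤ C * U i) (L k : ℕ) (hk : k < U (L + 1)) :
    k / U L < CU U := by
  obtain ⟨C, hC⟩ := hfin
  have hpos : ∀ L, 0 < U L := fun L => by
    have := hmono.monotone (Nat.zero_le L); omega
  have hb : BddAbove {c : ℕ | ∃ i, c = (U (i + 1) + U i - 1) / U i} := by
    refine ⟨C + 1, ?_⟩
    rintro c ⟨i, rfl⟩
    apply Nat.div_le_of_le_mul
    have := hC i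
    nlinarith [Nat.sub_le (U (i + 1) + U i) 1]
  have h1 : (U (L + 1) + U L - 1) / U L ≤ CU U := le_csSup hb ⟨L, rfl⟩
  have h2 : k / U L + 1 ≤ (U (L + 1) + U L - 1) / U L := by
    rw [← Nat.add_div_right _ (hpos L)]
    apply Nat.div_le_div_right
    omega
  omega

lemma grd_digits (U : ℕ → ℕ) (h0 : U 0 = 1) (hmono : StrictMono U)
    (hfin : ∃ C, ∀ i, U (i + 1) ≤ C * U i) (L k : ℕ) (hk : k < U L) :
    ∀ d ∈ grd U L k, d < CU U := by
  induction L generalizing k with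
  | zero => intro d hd; simp [grd] at hd
  | succ L ih =>
    have hpos : 0 < U L := by
      have := hmono.monotone (Nat.zero_le L); omega
    intro d hd
    rw [grd, List.mem_cons] at hd
    rcases hd with rfl | hd
    · exact div_lt_CU U h0 hmono hfin L k hk
    · exact ih _ (Nat.mod_lt _ hpos) d hd

lemma grd_pad (U : ℕ → ℕ) (hmono : StrictMono U) (L k i : ℕ) (hk : k < U L) (hi : L ≤ i) :
    grd U i k = List.replicate (i - L) 0 ++ grd U L k := by
  induction i, hi using Nat.le_induction with
  | base => simp
  | succ n hn ih =>
    have : k < U n := lt_of_lt_of_le hk (hmono.monotone hn)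
    rw [grd, Nat.div_eq_of_lt this, Nat.mod_eq_of_lt this, ih, Nat.succ_sub hn,
      List.replicate_succ, List.cons_append]

lemma word_mem (U : ℕ → ℕ) (h0 : U 0 = 1) (hmono : StrictMono U)
    (hfin : ∃ C, ∀ i, U (i + 1) ≤ C * U i) (X : Set ℕ) (L k i : ℕ) (hk : k < U L) (hi : L ≤ i)
    (hik : U i + k < U (i + 1)) :
    (1 :: List.replicate (i - L) 0) ++ grd U L k ∈ repLang U X ↔ U i + k ∈ X := by
  have hki : k < U i := lt_of_lt_of_le hk (hmono.monotone hi)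
  have hw : (1 :: List.replicate (i - L) 0) ++ grd U L k = grd U (i + 1) (U i + k) := by
    rw [grd, Nat.add_mod_left, Nat.mod_eq_of_lt hki, Nat.add_div_left _ (by omega),
      Nat.div_eq_of_lt hki, grd_pad U hmono L k i hk hi, List.cons_append]
  have hv := grd_val U h0 hmono (i + 1) (U i + k) hik
  rw [hw]
  constructor
  · rintro ⟨n, hn, hr, -⟩
    rw [hv] at hr
    rwa [hr]
  · intro h
    refine ⟨_, h, hv, grd_digits U h0 hmono hfin _ _ hik, ?_, ?_⟩
    · rw [← hw]; intro _; simp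
    · rw [grd_length]; exact grd_greedy U h0 hmono _ _ hik

lemma period_mul (X : Set ℕ) (a p : ℕ) (h : IsPeriodPair X a p) (q n : ℕ) (hn : a ≤ n) :
    n ∈ X ↔ n + p * q ∈ X := by
  induction q with
  | zero => simp
  | succ q ih => rw [ih, h.2 _ (by omega), Nat.mul_succ, add_assoc]

lemma period_dvd (X : Set ℕ) (a n m : ℕ) (h : IsPeriodPair X a (minPeriod X)) (hn : a ≤ n)
    (hnm : n ≤ m) (hk : ∀ k < minPeriod X, (n + k ∈ X ↔ m + k ∈ X)) :
    (n : ZMod (minPeriod X)) = m := by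
  set p := minPeriod X with hp
  have hall : ∀ k, (n + k ∈ X ↔ m + k ∈ X) := by
    intro k
    have h1 := hk (k % p) (Nat.mod_lt _ h.1)
    have e := Nat.mod_add_div k p
    rw [← e, ← add_assoc, ← add_assoc, ← period_mul X a p h _ _ (by omega),
      ← period_mul X a p h _ _ (by omega)]
    exact h1
  obtain ⟨d, rfl⟩ := Nat.exists_eq_add_of_le hnm
  have hr : d % p = 0 := by
    by_contra hne
    have hper : IsPeriodPair X n (d % p) := by
      refine ⟨Nat.pos_of_ne_zero hne, ?_⟩
      intro x hx
      obtain ⟨k, rfl⟩ := Nat.exists_eq_add_of_le hx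
      rw [hall k, period_mul X a p h (d / p) (n + k + d % p) (by omega)]
      have e := Nat.mod_add_div d p
      have : n + k + d % p + p * (d / p) = n + d + k := by omega
      rw [this]
    have hle : p ≤ d % p := Nat.sInf_le ⟨n, hper⟩
    have := Nat.mod_lt d h.1
    omega
  have : ((d : ℕ) : ZMod p) = 0 := (ZMod.natCast_eq_zero_iff d p).2 (Nat.dvd_of_mod_eq_zero hr)
  push_cast
  rw [this, add_zero]

/-- Let `U` be a positional numeration system with
`lim_{i→∞} (U_{i+1} - U_i) = +∞`.  If `X ⊆ ℕ` is an ultimately periodic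
`U`-recognizable set with minimal period `p_X`, then every deterministic finite
automaton over `A_U` accepting exactly the language `rep_U(X)` has at least
`N_U(p_X)` states. -/
theorem statement_2 (U : ℕ → ℕ) (hmono : StrictMono U) (h0 : U 0 = 1)
    (hfin : ∃ C, ∀ i, U (i + 1) ≤ C * U i)
    (hlim : Tendsto (fun i => U (i + 1) - U i) atTop atTop)
    (X : Set ℕ) (hX : UltPeriodic X)
    (σ : Type*) [Fintype σ] (M : DFA ℕ σ) (hM : M.accepts = repLang U X) :
    Ninf U (minPeriod X) ≤ Fintype.card σ := by
  obtain ⟨a, ha⟩ : ∃ a, IsPeriodPair X a (minPeriod X) := by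
    obtain ⟨a, p, h⟩ := hX
    exact Nat.sInf_mem (s := {p | ∃ a, IsPeriodPair X a p}) ⟨p, a, h⟩
  obtain ⟨N, hN⟩ := eventually_atTop.1 (hlim.eventually_ge_atTop (minPeriod X))
  set p := minPeriod X with hp
  have hLp : p ≤ U p := hmono.id_le p
  have hex : ∀ r : {r : ZMod p | ∀ N : ℕ, ∃ i, N ≤ i ∧ (U i : ZMod p) = r},
      ∃ i, (N + a + p) ≤ i ∧ (U i : ZMod p) = r := fun r => r.2 _
  choose f hf1 hf2 using hex
  unfold Ninf
  rw [← Nat.card_coe_set_eq, ← Nat.card_eq_fintype_card]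
  refine Nat.card_le_card_of_injective
    (fun r => M.eval (1 :: List.replicate (f r - p) 0)) ?_
  intro r s hrs
  have key : ∀ k < p, (U (f r) + k ∈ X ↔ U (f s) + k ∈ X) := by
    intro k hk
    have hkL : k < U p := by omega
    have hb : ∀ r, U (f r) + k < U (f r + 1) := by
      intro r
      have h1 := hN (f r) (by have := hf1 r; omega)
      omega
    rw [← word_mem U h0 hmono hfin X p k (f r) hkL (by have := hf1 r; omega) (hb r),
      ← word_mem U h0 hmono hfin X p k (f s) hkL (by have := hf1 s; omega) (hb s), ← hM,
      DFA.mem_accepts, DFA.mem_accepts]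
    simp only [DFA.eval, DFA.evalFrom_of_append] at hrs ⊢
    rw [hrs]
  have hge : ∀ r, a ≤ U (f r) := fun r => by
    have h1 := hmono.id_le (f r)
    have h2 := hf1 r
    simp only [id] at h1
    omega
  apply Subtype.ext
  rw [← hf2 r, ← hf2 s]
  rcases le_total (U (f r)) (U (f s)) with h | h
  · exact period_dvd X a _ _ ha (hge r) h key
  · exact (period_dvd X a _ _ ha (hge s) h (fun k hk => (key k hk).symm)).symm
end

section
/- Let U = (U_i)_{i≥0} be a sequence of integers satisfying a linear recurrence U_{i+k} = a_1 U_{i+k−1} + ⋯ + a_k U_i of order k with integer coefficients and a_k ≠ 0. Then for every m ≥ 1 the sequence (U_i mod m)_{i≥0} is ultimately periodic and N_U(m) ≤ π_U(m) ≤ (N_U(m))^k. Moreover, if m = p·q with gcd(p, q) = 1, then π_U(m) = lcm(π_U(p), π_U(q)). Consequently, lim_{m→∞} N_U(m) = +∞ if and only if lim_{m→∞} π_U(m) = +∞. -/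
open Filter

/-- `N_U(m)`: the number of residues mod `m` taken infinitely often by the
sequence `(U_i mod m)_{i ≥ 0}` of an integer sequence `U`. -/
noncomputable def NinfZ (s : ℕ → ℤ) (m : ℕ) : ℕ :=
  Set.ncard {r : ZMod m | ∀ N : ℕ, ∃ i, N ≤ i ∧ (s i : ZMod m) = r}

/-- `π_U(m)`: the minimal (eventual) period of the sequence `(U_i mod m)_{i ≥ 0}`. -/
noncomputable def piZ (s : ℕ → ℤ) (m : ℕ) : ℕ :=
  sInf {p : ℕ | 0 < p ∧ ∃ N : ℕ, ∀ i, N ≤ i → s (i + p) ≡ s i [ZMOD (m : ℤ)]}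

/-- `d` is an eventual period of `s` modulo `m` (zero allowed). -/
def EvPer (s : ℕ → ℤ) (m d : ℕ) : Prop :=
  ∃ N : ℕ, ∀ i, N ≤ i → s (i + d) ≡ s i [ZMOD (m : ℤ)]

theorem EvPer.mul {s : ℕ → ℤ} {m d : ℕ} (h : EvPer s m d) (c : ℕ) : EvPer s m (d * c) := by
  obtain ⟨N, hN⟩ := h
  refine ⟨N, fun i hi => ?_⟩
  induction c with
  | zero => simp
  | succ c ih =>
    have := hN (i + d * c) (by omega)
    have e : i + d * (c + 1) = i + d * c + d := by ring
    rw [e]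
    exact this.trans ih

theorem EvPer.mod {s : ℕ → ℤ} {m d e : ℕ} (hd : EvPer s m d) (he : EvPer s m e) :
    EvPer s m (e % d) := by
  obtain ⟨N, hN⟩ := hd.mul (e / d)
  obtain ⟨M, hM⟩ := he
  refine ⟨max N M, fun i hi => ?_⟩
  have h1 := hN (i + e % d) (by omega)
  have h2 := hM i (by omega)
  have e1 : i + e % d + d * (e / d) = i + e := by
    rw [add_assoc, Nat.mod_add_div]
  rw [e1] at h1
  exact h1.symm.trans h2

theorem piZ_spec {s : ℕ → ℤ} {m : ℕ} (h : ∃ p, 0 < p ∧ EvPer s m p) :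
    0 < piZ s m ∧ EvPer s m (piZ s m) :=
  Nat.sInf_mem (s := {p : ℕ | 0 < p ∧ ∃ N : ℕ, ∀ i, N ≤ i → s (i + p) ≡ s i [ZMOD (m : ℤ)]}) h

theorem piZ_le {s : ℕ → ℤ} {m p : ℕ} (h : 0 < p) (h' : EvPer s m p) : piZ s m ≤ p :=
  Nat.sInf_le ⟨h, h'⟩

theorem evPer_iff {s : ℕ → ℤ} {m : ℕ} (h : ∃ p, 0 < p ∧ EvPer s m p) (d : ℕ) :
    EvPer s m d ↔ piZ s m ∣ d := by
  obtain ⟨h0, h1⟩ := piZ_spec h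
  constructor
  · intro hd
    have h2 := h1.mod hd
    by_contra hn
    have h3 : 0 < d % piZ s m := Nat.pos_of_ne_zero fun h => hn (Nat.dvd_of_mod_eq_zero h)
    have := piZ_le h3 h2
    have := Nat.mod_lt d h0
    omega
  · rintro ⟨c, rfl⟩
    exact h1.mul c

theorem evPer_mul {s : ℕ → ℤ} {p q : ℕ} (h : Nat.Coprime p q) (d : ℕ) :
    EvPer s (p * q) d ↔ EvPer s p d ∧ EvPer s q d := by
  have key : ∀ x y : ℤ, x ≡ y [ZMOD ((p * q : ℕ) : ℤ)] ↔
      x ≡ y [ZMOD (p : ℤ)] ∧ x ≡ y [ZMOD (q : ℤ)] := by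
    intro x y
    rw [Int.modEq_and_modEq_iff_modEq_mul (by simpa using h)]
    simp
  constructor
  · rintro ⟨N, hN⟩
    exact ⟨⟨N, fun i hi => ((key _ _).1 (hN i hi)).1⟩, ⟨N, fun i hi => ((key _ _).1 (hN i hi)).2⟩⟩
  · rintro ⟨⟨N, hN⟩, ⟨M, hM⟩⟩
    exact ⟨max N M, fun i hi => (key _ _).2 ⟨hN i (by omega), hM i (by omega)⟩⟩

theorem ninf_le {s : ℕ → ℤ} {m p : ℕ} (hp : 0 < p) (h : EvPer s m p) :
    NinfZ s m ≤ p := by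
  obtain ⟨N, hN⟩ := h
  have hsub : {r : ZMod m | ∀ N : ℕ, ∃ i, N ≤ i ∧ (s i : ZMod m) = r} ⊆
      (((Finset.range p).image fun t => (s (N + t) : ZMod m) : Finset (ZMod m)) :
        Set (ZMod m)) := by
    intro r hr
    obtain ⟨i, hi, rfl⟩ := hr N
    have hc : ∀ c t : ℕ, (s (N + t + p * c) : ZMod m) = s (N + t) := by
      intro c t
      induction c with
      | zero => simp
      | succ c ih =>
        have := hN (N + t + p * c) (by omega)
        have e : N + t + p * (c + 1) = N + t + p * c + p := by ring
        rw [e, ← ih]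
        exact (ZMod.intCast_eq_intCast_iff _ _ _).2 this
    simp only [Finset.coe_image, Set.mem_image, Finset.coe_range, Set.mem_Iio]
    refine ⟨(i - N) % p, Nat.mod_lt _ hp, ?_⟩
    rw [← hc ((i - N) / p), add_assoc, Nat.mod_add_div]
    congr 2
    omega
  unfold NinfZ
  refine (Set.ncard_le_ncard hsub (Finset.finite_toSet _)).trans ?_
  rw [Set.ncard_coe_finset]
  exact Finset.card_image_le.trans (by simp)

theorem det_rec (U : ℕ → ℤ) (k : ℕ) (a : Fin k → ℤ)
    (hrec : ∀ i : ℕ, U (i + k) = ∑ j : Fin k, a j * U (i + k - 1 - (j : ℕ))) (m x y : ℕ)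
    (h : ∀ t < k, (U (x + t) : ZMod m) = U (y + t)) (t : ℕ) :
    (U (x + t) : ZMod m) = U (y + t) := by
  induction t using Nat.strong_induction_on with
  | _ t ih =>
    by_cases ht : t < k
    · exact h t ht
    · obtain ⟨u, rfl⟩ : ∃ u, t = u + k := ⟨t - k, by omega⟩
      rw [← add_assoc, ← add_assoc, hrec, hrec]
      push_cast
      refine Finset.sum_congr rfl fun j _ => ?_
      have hj := j.2
      have := ih (u + k - 1 - (j : ℕ)) (by omega)
      have e1 : x + u + k - 1 - (j : ℕ) = x + (u + k - 1 - (j : ℕ)) := by omega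
      have e2 : y + u + k - 1 - (j : ℕ) = y + (u + k - 1 - (j : ℕ)) := by omega
      rw [e1, e2, this]

theorem exists_per (U : ℕ → ℤ) (k : ℕ) (a : Fin k → ℤ)
    (hrec : ∀ i : ℕ, U (i + k) = ∑ j : Fin k, a j * U (i + k - 1 - (j : ℕ))) (m : ℕ)
    (hm : 1 ≤ m) : ∃ p, 0 < p ∧ p ≤ NinfZ U m ^ k ∧ EvPer U m p := by
  classical
  haveI : NeZero m := ⟨by omega⟩
  set S : Set (ZMod m) := {r : ZMod m | ∀ N : ℕ, ∃ i, N ≤ i ∧ (U i : ZMod m) = r} with hS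
  have h1 : ∀ r : ZMod m, ∃ N : ℕ, r ∉ S → ∀ i, N ≤ i → (U i : ZMod m) ≠ r := by
    intro r
    by_cases hr : r ∈ S
    · exact ⟨0, fun h => absurd hr h⟩
    · have hr' := hr
      simp only [hS, Set.mem_setOf_eq] at hr'
      push Not at hr'
      obtain ⟨N, hN⟩ := hr'
      exact ⟨N, fun _ => hN⟩
  choose f hf using h1
  obtain ⟨N, hN⟩ : ∃ N, ∀ r, f r ≤ N :=
    ⟨Finset.univ.sup f, fun r => Finset.le_sup (Finset.mem_univ r)⟩
  have h2 : ∀ i, N ≤ i → (U i : ZMod m) ∈ S := by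
    intro i hi
    by_contra h
    exact hf _ h i ((hN _).trans hi) rfl
  have hcard : Fintype.card (Fin k → S) = NinfZ U m ^ k := by
    rw [Fintype.card_fun, Fintype.card_fin]
    congr 1
    rw [← Nat.card_eq_fintype_card]
    rfl
  let g : Fin (NinfZ U m ^ k + 1) → (Fin k → S) :=
    fun x t => ⟨(U (N + x + t) : ZMod m), h2 _ (by omega)⟩
  obtain ⟨x, y, hxy, hg⟩ := Fintype.exists_ne_map_eq_of_card_lt g (by rw [hcard]; simp)
  have main : ∀ x y : Fin (NinfZ U m ^ k + 1), x < y → g x = g y →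
      ∃ p, 0 < p ∧ p ≤ NinfZ U m ^ k ∧ EvPer U m p := by
    intro x y hlt hg
    have hlt' : (x : ℕ) < y := hlt
    have hy := y.2
    refine ⟨y - x, by omega, by omega, N + x, fun i hi => ?_⟩
    have hd := det_rec U k a hrec m (N + x) (N + y)
      (fun t ht => congrArg Subtype.val (congrFun hg ⟨t, ht⟩)) (i - (N + x))
    rw [← ZMod.intCast_eq_intCast_iff]
    have e1 : N + (x : ℕ) + (i - (N + x)) = i := by omega
    have e2 : N + (y : ℕ) + (i - (N + x)) = i + (y - x) := by omega
    rw [e1, e2] at hd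
    exact hd.symm
  rcases lt_or_gt_of_ne hxy with h | h
  · exact main x y h hg
  · exact main y x h hg.symm

/-- Let `U = (U_i)` be an integer sequence satisfying a linear recurrence
`U_{i+k} = a_1 U_{i+k-1} + ⋯ + a_k U_i` of order `k` with integer coefficients
and `a_k ≠ 0` (here `a ⟨j⟩` is the coefficient `a_{j+1}`).  Then for every
`m ≥ 1` the sequence `(U_i mod m)` is ultimately periodic and
`N_U(m) ≤ π_U(m) ≤ (N_U(m))^k`; if `m = p·q` with `gcd(p,q) = 1` then
`π_U(m) = lcm(π_U(p), π_U(q))`; and `lim_{m→∞} N_U(m) = +∞` iff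
`lim_{m→∞} π_U(m) = +∞`. -/
theorem statement_5 (U : ℕ → ℤ) (k : ℕ) (hk : 0 < k) (a : Fin k → ℤ)
    (hak : a ⟨k - 1, Nat.sub_lt hk Nat.one_pos⟩ ≠ 0)
    (hrec : ∀ i : ℕ, U (i + k) = ∑ j : Fin k, a j * U (i + k - 1 - (j : ℕ))) :
    (∀ m : ℕ, 1 ≤ m →
      (∃ p, 0 < p ∧ ∃ N : ℕ, ∀ i, N ≤ i → U (i + p) ≡ U i [ZMOD (m : ℤ)]) ∧
      NinfZ U m ≤ piZ U m ∧ piZ U m ≤ (NinfZ U m) ^ k) ∧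
    (∀ p q : ℕ, 1 ≤ p → 1 ≤ q → Nat.Coprime p q →
      piZ U (p * q) = Nat.lcm (piZ U p) (piZ U q)) ∧
    (Tendsto (fun m => NinfZ U m) atTop atTop ↔
      Tendsto (fun m => piZ U m) atTop atTop) := by
  have hex := exists_per U k a hrec
  have hex' : ∀ m : ℕ, 1 ≤ m → ∃ p, 0 < p ∧ EvPer U m p := fun m hm => by
    obtain ⟨p, hp, _, h⟩ := hex m hm
    exact ⟨p, hp, h⟩
  have hlow : ∀ m : ℕ, 1 ≤ m → NinfZ U m ≤ piZ U m := fun m hm =>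
    ninf_le (piZ_spec (hex' m hm)).1 (piZ_spec (hex' m hm)).2
  have hup : ∀ m : ℕ, 1 ≤ m → piZ U m ≤ NinfZ U m ^ k := fun m hm => by
    obtain ⟨p, hp, hle, h⟩ := hex m hm
    exact (piZ_le hp h).trans hle
  refine ⟨fun m hm => ⟨hex' m hm, hlow m hm, hup m hm⟩, ?_, ?_, ?_⟩
  · intro p q hp hq hpq
    have key : ∀ d, piZ U (p * q) ∣ d ↔ Nat.lcm (piZ U p) (piZ U q) ∣ d := fun d => by
      rw [← evPer_iff (hex' _ (Nat.mul_pos hp hq)), evPer_mul hpq, evPer_iff (hex' p hp),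
        evPer_iff (hex' q hq), Nat.lcm_dvd_iff]
    exact Nat.dvd_antisymm ((key _).2 dvd_rfl) ((key _).1 dvd_rfl)
  · intro h
    refine tendsto_atTop_mono' atTop ?_ h
    filter_upwards [eventually_ge_atTop 1] with m hm using hlow m hm
  · intro h
    rw [tendsto_atTop] at h ⊢
    intro b
    filter_upwards [eventually_ge_atTop 1, h (b ^ k + 1)] with m hm hb
    by_contra hlt
    have h3 := hup m hm
    have h4 : NinfZ U m ^ k ≤ b ^ k := Nat.pow_le_pow_left (by omega) k
    omega
end

section
/- Let U = (U_i)_{i≥0} be a linear numeration system and X ⊆ ℕ an ultimately periodic U-recognizable set with minimal period p_X and minimal preperiod a_X ≥ 1. Then every deterministic finite automaton over A_U whose accepted language is rep_U(X) has at least |rep_U(a_X − 1)| − ι_U(p_X) states. -/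
open Filter

/-- The minimal (eventual) period of a sequence of naturals. -/
noncomputable def seqMinPeriod (s : ℕ → ℕ) : ℕ :=
  sInf {p : ℕ | 0 < p ∧ ∃ N : ℕ, ∀ i, N ≤ i → s (i + p) = s i}

/-- The minimal preperiod of a sequence of naturals (relative to its minimal
period). -/
noncomputable def seqMinPreperiod (s : ℕ → ℕ) : ℕ :=
  sInf {N : ℕ | ∀ i, N ≤ i → s (i + seqMinPeriod s) = s i}

/-- `ι_U(m)`: the minimal preperiod of the ultimately periodic sequence
`(U_i mod m)_{i ≥ 0}`. -/
noncomputable def iotaU (U : ℕ → ℕ) (m : ℕ) : ℕ :=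
  seqMinPreperiod (fun i => U i % m)

open Polynomial in
/-- A sequence satisfies some linear recurrence with nonzero constant term. -/
def InvRec (b : ℕ → ℚ) : Prop :=
  ∃ P : ℚ[X], P.coeff 0 ≠ 0 ∧ Polynomial.aeval (LinearMap.funLeft ℚ ℚ Nat.succ) P b = 0

lemma shift_pow (m : ℕ) (b : ℕ → ℚ) (j : ℕ) :
    ((LinearMap.funLeft ℚ ℚ Nat.succ) ^ m) b j = b (j + m) := by
  induction m generalizing j with
  | zero => simp
  | succ m ih =>
    rw [pow_succ', Module.End.mul_apply, LinearMap.funLeft_apply, ih]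
    congr 1; simp only [Nat.succ_eq_add_one]; omega

lemma aeval_shift (P : Polynomial ℚ) (b : ℕ → ℚ) (j : ℕ) :
    Polynomial.aeval (LinearMap.funLeft ℚ ℚ Nat.succ) P b j
      = ∑ k ∈ Finset.range (P.natDegree + 1), P.coeff k * b (j + k) := by
  rw [Polynomial.aeval_eq_sum_range]
  simp [LinearMap.sum_apply, shift_pow]

lemma InvRec.zero_of {b : ℕ → ℚ} (h : InvRec b) (hb : ∀ j, 1 ≤ j → b j = 0) : b 0 = 0 := by
  obtain ⟨P, hP, hz⟩ := h
  have := congrFun hz 0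
  rw [aeval_shift, Finset.sum_range_succ'] at this
  rw [Finset.sum_eq_zero (fun k _ => by rw [hb _ (by omega), mul_zero])] at this
  simpa [hP] using this

lemma InvRec.add {b c : ℕ → ℚ} (hb : InvRec b) (hc : InvRec c) : InvRec (b + c) := by
  obtain ⟨P, hP, hz⟩ := hb
  obtain ⟨Q, hQ, hy⟩ := hc
  refine ⟨P * Q, by simp [Polynomial.mul_coeff_zero, hP, hQ], ?_⟩
  rw [map_add]
  have h1 : Polynomial.aeval (LinearMap.funLeft ℚ ℚ Nat.succ) (P * Q) b = 0 := by
    rw [mul_comm, map_mul, Module.End.mul_apply, hz, map_zero]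
  have h2 : Polynomial.aeval (LinearMap.funLeft ℚ ℚ Nat.succ) (P * Q) c = 0 := by
    rw [map_mul, Module.End.mul_apply, hy, map_zero]
  rw [h1, h2, add_zero]

lemma InvRec.smul {b : ℕ → ℚ} (r : ℚ) (hb : InvRec b) : InvRec (r • b) := by
  obtain ⟨P, hP, hz⟩ := hb
  exact ⟨P, hP, by rw [map_smul, hz, smul_zero]⟩

lemma InvRec.shift {b : ℕ → ℚ} (m : ℕ) (hb : InvRec b) : InvRec (fun j => b (j + m)) := by
  obtain ⟨P, hP, hz⟩ := hb
  refine ⟨P, hP, ?_⟩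
  funext j
  rw [aeval_shift]
  have := congrFun hz (j + m)
  rw [aeval_shift] at this
  simpa [add_right_comm] using this

lemma InvRec.sub {b c : ℕ → ℚ} (hb : InvRec b) (hc : InvRec c) : InvRec (b - c) := by
  have := hb.add (hc.smul (-1))
  simpa [sub_eq_add_neg] using this

lemma InvRec.periodic {b : ℕ → ℚ} (π : ℕ) (hπ : 0 < π) (h : ∀ j, b (j + π) = b j) :
    InvRec b := by
  refine ⟨Polynomial.X ^ π - 1, by simp [Polynomial.coeff_X_pow, hπ.ne], ?_⟩
  funext j
  simp [shift_pow, h]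

lemma InvRec.linear (U : ℕ → ℕ) (k : ℕ) (hk : 0 < k) (a : Fin k → ℤ)
    (hak : a ⟨k - 1, Nat.sub_lt hk Nat.one_pos⟩ ≠ 0)
    (hrec : ∀ i : ℕ, (U (i + k) : ℤ) = ∑ j : Fin k, a j * U (i + k - 1 - (j : ℕ))) :
    InvRec (fun i => (U i : ℚ)) := by
  refine ⟨Polynomial.X ^ k - ∑ j : Fin k, Polynomial.C (a j : ℚ) * Polynomial.X ^ (k - 1 - (j : ℕ)),
    ?_, ?_⟩
  · simp only [Polynomial.coeff_sub, Polynomial.finsetSum_coeff, Polynomial.coeff_X_pow,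
      Polynomial.coeff_C_mul, hk.ne, if_false, zero_sub, neg_ne_zero]
    rw [Finset.sum_eq_single (⟨k - 1, Nat.sub_lt hk Nat.one_pos⟩ : Fin k)]
    · simpa using hak
    · intro j _ hj
      have : (j : ℕ) ≠ k - 1 := fun h => hj (Fin.ext h)
      have := j.2
      rw [if_neg (by omega), mul_zero]
    · simp
  · funext i
    have h := hrec i
    have h' : (U (i + k) : ℚ) = ∑ j : Fin k, (a j : ℚ) * U (i + k - 1 - (j : ℕ)) := by
      exact_mod_cast h
    simp only [map_sub, map_pow, map_sum, map_mul, Polynomial.aeval_X, Polynomial.aeval_C,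
      LinearMap.sub_apply, LinearMap.sum_apply, Pi.sub_apply, Finset.sum_apply, shift_pow,
      Module.End.mul_apply, Module.algebraMap_end_apply, Pi.smul_apply, smul_eq_mul, Pi.zero_apply]
    rw [h', sub_eq_zero]
    refine Finset.sum_congr rfl fun j _ => ?_
    have := j.2
    congr 3; omega

lemma InvRec.ofLinear {σ : Type*} [Fintype σ] (A : (σ → ℚ) →ₗ[ℚ] (σ → ℚ)) (f : σ → ℚ) (q : σ) :
    InvRec (fun i => (A ^ (i + Fintype.card σ)) f q) := by
  classical
  have hne : A.charpoly ≠ 0 := A.charpoly_monic.ne_zero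
  obtain ⟨Q, hQ, hnd⟩ := Polynomial.exists_eq_pow_rootMultiplicity_mul_and_not_dvd A.charpoly hne 0
  set m := A.charpoly.rootMultiplicity 0
  simp only [map_zero, sub_zero] at hQ hnd
  have hdeg : m ≤ Fintype.card σ := by
    have h1 : m ≤ A.charpoly.natDegree := by
      have hd : Polynomial.X ^ m ∣ A.charpoly := ⟨Q, hQ⟩
      simpa using Polynomial.natDegree_le_of_dvd hd hne
    have h2 := A.charpoly_natDegree
    rw [Module.finrank_fintype_fun_eq_card] at h2
    omega
  have hc : Polynomial.aeval A A.charpoly = 0 := A.aeval_self_charpoly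
  rw [hQ, map_mul, map_pow, Polynomial.aeval_X] at hc
  refine ⟨Q, fun h => hnd (Polynomial.X_dvd_iff.2 h), ?_⟩
  funext i
  rw [aeval_shift]
  have h3 : (A ^ (i + (Fintype.card σ - m))) * (A ^ m * Polynomial.aeval A Q) = 0 := by
    rw [hc, mul_zero]
  rw [← mul_assoc, ← pow_add, show i + (Fintype.card σ - m) + m = i + Fintype.card σ by omega,
    Polynomial.aeval_eq_sum_range, Finset.mul_sum] at h3
  have h4 := congrFun (congrArg (fun L : (σ → ℚ) →ₗ[ℚ] (σ → ℚ) => L f) h3) q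
  simp only [LinearMap.sum_apply, Finset.sum_apply, mul_smul_comm, ← pow_add,
    LinearMap.smul_apply, Pi.smul_apply, smul_eq_mul, LinearMap.zero_apply] at h4
  refine Eq.trans ?_ h4
  refine Finset.sum_congr rfl fun j _ => ?_
  rw [show i + j + Fintype.card σ = i + Fintype.card σ + j by omega]

/-! Counting words of a DFA -/

/-- words of length `i` over `{0,…,C-1}` accepted from `q`. -/
noncomputable def wordsFrom {σ : Type*} (M : DFA ℕ σ) (C : ℕ) : ℕ → σ → Finset (List ℕ)
  | 0, q => by classical exact if q ∈ M.accept then {[]} else ∅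
  | i + 1, q => (Finset.range C).biUnion fun d =>
      (wordsFrom M C i (M.step q d)).image (List.cons d)

lemma mem_wordsFrom {σ : Type*} (M : DFA ℕ σ) (C i : ℕ) (q : σ) (w : List ℕ) :
    w ∈ wordsFrom M C i q ↔ w.length = i ∧ (∀ d ∈ w, d < C) ∧ M.evalFrom q w ∈ M.accept := by
  classical
  induction i generalizing q w with
  | zero =>
    rw [wordsFrom]
    by_cases h : q ∈ M.accept
    · rw [if_pos h]
      cases w <;> simp [h]
    · rw [if_neg h]
      cases w <;> simp [h]
  | succ i ih =>
    rw [wordsFrom]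
    simp only [Finset.mem_biUnion, Finset.mem_image, Finset.mem_range]
    constructor
    · rintro ⟨d, hd, v, hv, rfl⟩
      rw [ih] at hv
      refine ⟨by simp [hv.1], ?_, by simpa using hv.2.2⟩
      intro e he
      rcases List.mem_cons.1 he with rfl | he
      · exact hd
      · exact hv.2.1 e he
    · rintro ⟨h1, h2, h3⟩
      cases w with
      | nil => simp at h1
      | cons d v =>
        refine ⟨d, h2 d (by simp), v, ?_, rfl⟩
        rw [ih]
        exact ⟨by simpa using h1, fun e he => h2 e (by simp [he]), by simpa using h3⟩

/-- transfer operator -/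
noncomputable def transfer {σ : Type*} (M : DFA ℕ σ) (C : ℕ) : (σ → ℚ) →ₗ[ℚ] (σ → ℚ) where
  toFun f q := ∑ d ∈ Finset.range C, f (M.step q d)
  map_add' f g := by funext q; simp [Finset.sum_add_distrib]
  map_smul' r f := by funext q; simp [Finset.mul_sum]

lemma card_wordsFrom {σ : Type*} (M : DFA ℕ σ) (C i : ℕ) :
    (fun q => ((wordsFrom M C i q).card : ℚ))
      = (transfer M C ^ i) (fun q => ((wordsFrom M C 0 q).card : ℚ)) := by
  classical
  induction i with
  | zero => simp
  | succ i ih =>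
    rw [pow_succ', Module.End.mul_apply, ← ih]
    funext q
    simp only [transfer, LinearMap.coe_mk, AddHom.coe_mk]
    rw [wordsFrom, Finset.card_biUnion]
    · push_cast
      refine Finset.sum_congr rfl fun d _ => ?_
      rw [Finset.card_image_of_injective _ (List.cons_injective)]
    · intro d _ e _ hde
      refine Finset.disjoint_left.2 ?_
      intro v hv hv'
      simp only [Finset.mem_image] at hv hv'
      obtain ⟨a, _, rfl⟩ := hv
      obtain ⟨b, _, hb⟩ := hv'
      simp at hb
      exact hde hb.1.symm

lemma valU_nil (U : ℕ → ℕ) : valU U [] = 0 := by simp [valU]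

/-- recursive greedy condition -/
def Gr (U : ℕ → ℕ) : List ℕ → Prop
  | [] => True
  | d :: w => valU U (d :: w) < U (w.length + 1) ∧ Gr U w

lemma gr_iff (U : ℕ → ℕ) (w : List ℕ) :
    Gr U w ↔ ∀ t < w.length, ∑ i ∈ Finset.range (t + 1), w.reverse.getD i 0 * U i < U (t + 1) := by
  induction w with
  | nil => simp [Gr]
  | cons d w ih =>
    have key : ∀ t < w.length, ∑ i ∈ Finset.range (t + 1), (d :: w).reverse.getD i 0 * U i
        = ∑ i ∈ Finset.range (t + 1), w.reverse.getD i 0 * U i := by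
      intro t ht
      refine Finset.sum_congr rfl fun i hi => ?_
      rw [Finset.mem_range] at hi
      have : i < w.length := by omega
      simp [List.getD_eq_getElem?_getD, List.getElem?_append, this]
    rw [Gr, ih]
    constructor
    · rintro ⟨h1, h2⟩ t ht
      rw [List.length_cons] at ht
      rcases Nat.lt_succ_iff_lt_or_eq.1 ht with h | rfl
      · rw [key t h]; exact h2 t h
      · exact h1
    · intro h
      refine ⟨h w.length (by simp), fun t ht => ?_⟩
      rw [← key t ht]; exact h t (by simp; omega)

lemma Gr.lt {U : ℕ → ℕ} (h0 : U 0 = 1) {w : List ℕ} (h : Gr U w) : valU U w < U w.length := by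
  cases w with
  | nil => simp [valU_nil, h0]
  | cons d w => exact h.1

lemma gr_inj {U : ℕ → ℕ} (h0 : U 0 = 1) (w v : List ℕ) (hl : w.length = v.length)
    (hw : Gr U w) (hv : Gr U v) (he : valU U w = valU U v) : w = v := by
  induction w generalizing v with
  | nil => cases v with
    | nil => rfl
    | cons _ _ => simp at hl
  | cons d w ih =>
    cases v with
    | nil => simp at hl
    | cons e v =>
      have hl' : w.length = v.length := by simpa using hl
      rw [valU_cons, valU_cons, ← hl'] at he
      have h1 := Gr.lt h0 hw.2
      have h2 := Gr.lt h0 hv.2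
      rw [← hl'] at h2
      have hd : d = e := by
        have a1 := congrArg (· / U w.length) he
        have hp : 0 < U w.length := by omega
        simp only [Nat.mul_comm _ (U w.length), Nat.mul_add_div hp, Nat.div_eq_of_lt h1,
          Nat.div_eq_of_lt h2] at a1
        simpa using a1
      subst hd
      rw [ih v hl' hw.2 hv.2 (by omega)]

lemma gr_exists {U : ℕ → ℕ} (hmono : StrictMono U) (h0 : U 0 = 1)
    (hfin : ∃ C, ∀ i, U (i + 1) ≤ C * U i) (i n : ℕ) (hn : n < U i) :
    ∃ w : List ℕ, w.length = i ∧ Gr U w ∧ valU U w = n ∧ ∀ d ∈ w, d < CU U := by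
  have hpos : ∀ i, 0 < U i := fun i => by
    have := hmono.monotone (Nat.zero_le i); omega
  induction i generalizing n with
  | zero => exact ⟨[], rfl, trivial, by rw [valU_nil]; omega, by simp⟩
  | succ i ih =>
    obtain ⟨w, hl, hg, hv, hd⟩ := ih (n % U i) (Nat.mod_lt _ (hpos i))
    have hval : valU U (n / U i :: w) = n := by
      rw [valU_cons, hl, hv, mul_comm]; exact Nat.div_add_mod n (U i)
    refine ⟨n / U i :: w, by simp [hl], ⟨by rw [hval, hl]; exact hn, hg⟩, hval, ?_⟩
    intro d hdm
    rcases List.mem_cons.1 hdm with rfl | hdm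
    · have hle : (U (i + 1) + U i - 1) / U i ≤ CU U := by
        refine le_csSup ?_ ⟨i, rfl⟩
        obtain ⟨C, hC⟩ := hfin
        refine ⟨C + 1, ?_⟩
        rintro c ⟨j, rfl⟩
        refine Nat.div_le_of_le_mul ?_
        have := hC j
        nlinarith [Nat.sub_le (U (j + 1) + U j) 1]
      refine lt_of_lt_of_le ?_ hle
      rw [show U (i + 1) + U i - 1 = (U (i + 1) - 1) + U i by have := hpos (i + 1); omega,
        Nat.add_div_right _ (hpos i)]
      exact Nat.lt_succ_of_le (Nat.div_le_div_right (by omega))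
    · exact hd d hdm

lemma greedy_range {U : ℕ → ℕ} (h0 : U 0 = 1) {n : ℕ} {w : List ℕ} {i : ℕ}
    (h : IsGreedyRep U n w) (hl : w.length = i + 1) : U i ≤ n ∧ n < U (i + 1) := by
  obtain ⟨h1, h2, h3, h4⟩ := h
  rw [← gr_iff] at h4
  cases w with
  | nil => simp at hl
  | cons d w =>
    have hl' : w.length = i := by simpa using hl
    have := Gr.lt h0 h4
    rw [h1, hl] at this
    refine ⟨?_, this⟩
    rw [← h1, valU_cons, hl']
    have hd : d ≠ 0 := by simpa using h3 (by simp)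
    have : 1 * U i ≤ d * U i := Nat.mul_le_mul_right _ (Nat.one_le_iff_ne_zero.2 hd)
    omega

lemma greedy_exists {U : ℕ → ℕ} (hmono : StrictMono U) (h0 : U 0 = 1)
    (hfin : ∃ C, ∀ i, U (i + 1) ≤ C * U i) (i n : ℕ) (hn : U i ≤ n) (hn' : n < U (i + 1)) :
    ∃ w : List ℕ, w.length = i + 1 ∧ IsGreedyRep U n w := by
  obtain ⟨w, hl, hg, hv, hd⟩ := gr_exists hmono h0 hfin (i + 1) n hn'
  refine ⟨w, hl, hv, hd, ?_, (gr_iff U w).1 hg⟩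
  intro hne
  cases w with
  | nil => simp at hl
  | cons d w =>
    rintro hz
    have hz : d = 0 := by simpa using hz
    subst hz
    rw [valU_cons] at hv
    have := Gr.lt h0 hg.2
    have hl' : w.length = i := by simpa using hl
    rw [hl'] at this
    omega

open Classical in
lemma count_block {U : ℕ → ℕ} (hmono : StrictMono U) (h0 : U 0 = 1)
    (hfin : ∃ C, ∀ i, U (i + 1) ≤ C * U i) (X : Set ℕ)
    {σ : Type*} (M : DFA ℕ σ) (hM : M.accepts = repLang U X) (i : ℕ) :
    (wordsFrom M (CU U) (i + 1) M.start).card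
      = ((Finset.Ico (U i) (U (i + 1))).filter (· ∈ X)).card := by
  have hacc : ∀ w, M.evalFrom M.start w ∈ M.accept ↔ ∃ n ∈ X, IsGreedyRep U n w := by
    intro w
    have : w ∈ M.accepts ↔ w ∈ repLang U X := by rw [hM]
    exact this
  refine Finset.card_bij (fun w _ => valU U w) ?_ ?_ ?_
  · intro w hw
    rw [mem_wordsFrom, hacc] at hw
    obtain ⟨hl, _, n, hn, hg⟩ := hw
    have := greedy_range h0 hg hl
    have e := hg.1
    simp only [Finset.mem_filter, Finset.mem_Ico, e]
    exact ⟨this, hn⟩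
  · intro w hw v hv he
    rw [mem_wordsFrom, hacc] at hw hv
    obtain ⟨hl, _, n, hn, hg⟩ := hw
    obtain ⟨hl', _, n', hn', hg'⟩ := hv
    exact gr_inj h0 w v (by omega) ((gr_iff _ _).2 hg.2.2.2) ((gr_iff _ _).2 hg'.2.2.2) he
  · intro n hn
    simp only [Finset.mem_filter, Finset.mem_Ico] at hn
    obtain ⟨w, hl, hg⟩ := greedy_exists hmono h0 hfin i n hn.1.1 hn.1.2
    refine ⟨w, ?_, hg.1⟩
    rw [mem_wordsFrom, hacc]
    exact ⟨hl, hg.2.1, n, hn.2, hg⟩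

/-! Pumping -/

lemma valU_append (U : ℕ → ℕ) (u v : List ℕ) :
    valU U (u ++ v) = valU (fun i => U (i + v.length)) u + valU U v := by
  induction u with
  | nil => simp [valU_nil]
  | cons d u ih =>
    rw [List.cons_append, valU_cons, valU_cons, ih, List.length_append]; ring

lemma valU_modEq {p : ℕ} {U V : ℕ → ℕ} (h : ∀ i, U i ≡ V i [MOD p]) (u : List ℕ) :
    valU U u ≡ valU V u [MOD p] := by
  induction u with
  | nil => rw [valU_nil, valU_nil]
  | cons d u ih =>
    rw [valU_cons, valU_cons]
    exact ((h _).mul_left d).add ih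

lemma per_mul {p π N : ℕ} {U : ℕ → ℕ} (h : ∀ i, N ≤ i → U (i + π) ≡ U i [MOD p])
    (j i : ℕ) (hi : N ≤ i) : U (i + j * π) ≡ U i [MOD p] := by
  induction j with
  | zero => simp; rfl
  | succ j ih =>
    rw [show i + (j + 1) * π = (i + j * π) + π by ring]
    exact (h _ (by omega)).trans ih

lemma length_rep (y : List ℕ) (j : ℕ) : (List.replicate j y).flatten.length = j * y.length := by
  simp

lemma pump_val {p π N : ℕ} {U : ℕ → ℕ} (h : ∀ i, N ≤ i → U (i + π) ≡ U i [MOD p])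
    (x y z : List ℕ) (hz : N ≤ z.length) :
    valU U (x ++ (List.replicate (p * π) y).flatten ++ z) ≡ valU U (x ++ z) [MOD p] := by
  set Y := (List.replicate π y).flatten with hY
  have hYl : Y.length = y.length * π := by rw [hY, length_rep, mul_comm]
  have hrep : (List.replicate (p * π) y).flatten = (List.replicate p Y).flatten := by
    rw [hY]
    generalize p = m
    induction m with
    | zero => simp
    | succ m ih => rw [Nat.succ_mul, Nat.add_comm, List.replicate_add, List.flatten_append, ih,
        List.replicate_succ, List.flatten_cons]
  have hsh : ∀ (j : ℕ) (u : List ℕ),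
      valU (fun i => U (i + ((List.replicate j Y).flatten ++ z).length)) u
        ≡ valU (fun i => U (i + z.length)) u [MOD p] := by
    intro j u
    refine valU_modEq (fun i => ?_) u
    have : i + ((List.replicate j Y).flatten ++ z).length
        = (i + z.length) + (j * y.length) * π := by
      rw [List.length_append, length_rep, hYl]; ring
    show U (i + ((List.replicate j Y).flatten ++ z).length) ≡ _ [MOD p]
    rw [this]
    exact per_mul h _ _ (by omega)
  have hin : ∀ j, valU U ((List.replicate j Y).flatten ++ z)
      ≡ j * valU (fun i => U (i + z.length)) Y + valU U z [MOD p] := by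
    intro j
    induction j with
    | zero => simp; rfl
    | succ j ih =>
      rw [List.replicate_succ, List.flatten_cons, List.append_assoc, valU_append]
      have := (hsh j Y).add ih
      refine this.trans ?_
      rw [Nat.succ_mul]
      rw [show ∀ a b c : ℕ, a + (b + c) = b + a + c by intros; ring]
  rw [hrep, List.append_assoc, valU_append, valU_append U x z]
  refine (hsh p x).add ((hin p).trans ?_)
  simp [Nat.ModEq]

/-! Eventual periodicity -/

lemma ev_periodic (U : ℕ → ℕ) (k : ℕ) (hk : 0 < k) (a : Fin k → ℤ)
    (hrec : ∀ i : ℕ, (U (i + k) : ℤ) = ∑ j : Fin k, a j * U (i + k - 1 - (j : ℕ)))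
    (p : ℕ) (hp : 0 < p) : ∃ π, 0 < π ∧ ∃ N, ∀ i, N ≤ i → U (i + π) % p = U i % p := by
  have : NeZero p := ⟨hp.ne'⟩
  obtain ⟨i, j, hij, he⟩ := Finite.exists_ne_map_eq_of_infinite
    (fun i : ℕ => (fun t : Fin k => (U (i + t) : ZMod p)))
  have main : ∀ i j : ℕ, i < j → ((fun t : Fin k => (U (i + t) : ZMod p)) =
      fun t : Fin k => (U (j + t) : ZMod p)) →
      ∃ π, 0 < π ∧ ∃ N, ∀ i, N ≤ i → U (i + π) % p = U i % p := by
    intro i j hij he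
    have hall : ∀ m, (U (i + m) : ZMod p) = U (j + m) := by
      intro m
      induction m using Nat.strong_induction_on with
      | _ m ih =>
        by_cases hm : m < k
        · exact congrFun he ⟨m, hm⟩
        · have cast : ∀ i : ℕ, (U (i + k) : ZMod p)
              = ∑ j : Fin k, (a j : ZMod p) * U (i + k - 1 - (j : ℕ)) := by
            intro i
            have := congrArg (Int.cast : ℤ → ZMod p) (hrec i)
            push_cast at this
            exact this
          have e1 := cast (i + (m - k))
          have e2 := cast (j + (m - k))
          rw [show i + (m - k) + k = i + m by omega] at e1
          rw [show j + (m - k) + k = j + m by omega] at e2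
          rw [e1, e2]
          refine Finset.sum_congr rfl fun t _ => ?_
          have := t.2
          have := ih (m - 1 - t) (by omega)
          rw [show i + m - 1 - (t : ℕ) = i + (m - 1 - t) by omega, this,
            show j + m - 1 - (t : ℕ) = j + (m - 1 - t) by omega]
    refine ⟨j - i, by omega, i, fun l hl => ?_⟩
    have := hall (l - i)
    rw [show i + (l - i) = l by omega, show j + (l - i) = l + (j - i) by omega] at this
    exact ((ZMod.natCast_eq_natCast_iff' _ _ _).1 this).symm
  rcases lt_or_gt_of_ne hij with h | h
  · exact main i j h he
  · exact main j i h he.symm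

lemma iota_spec (U : ℕ → ℕ) (k : ℕ) (hk : 0 < k) (a : Fin k → ℤ)
    (hrec : ∀ i : ℕ, (U (i + k) : ℤ) = ∑ j : Fin k, a j * U (i + k - 1 - (j : ℕ)))
    (p : ℕ) (hp : 0 < p) : ∃ π, 0 < π ∧ ∀ i, iotaU U p ≤ i → U (i + π) ≡ U i [MOD p] := by
  have hne := ev_periodic U k hk a hrec p hp
  have h1 : seqMinPeriod (fun i => U i % p) ∈
      {q : ℕ | 0 < q ∧ ∃ N : ℕ, ∀ i, N ≤ i → (fun i => U i % p) (i + q) = (fun i => U i % p) i} :=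
    Nat.sInf_mem hne
  obtain ⟨hpos, hN⟩ := h1
  exact ⟨_, hpos, Nat.sInf_mem hN⟩

/-! Counting the periodic set -/

open Classical in
lemma count_periodic (Y : Set ℕ) (p : ℕ) (hp : 0 < p) (hY : ∀ n, n ∈ Y ↔ n + p ∈ Y)
    (U : ℕ → ℕ) (hU : InvRec (fun i => (U i : ℚ))) (π N : ℕ) (hπ : 0 < π)
    (hper : ∀ i, N ≤ i → U (i + π) ≡ U i [MOD p]) :
    InvRec (fun j => (Nat.count (· ∈ Y) (U (j + N)) : ℚ)) := by
  set T : ℕ → ℕ := Nat.count (· ∈ Y) with hT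
  have hTp : ∀ x, T (x + p) = T x + T p := by
    intro x
    rw [hT, Nat.count_add']
    congr 2
    funext y
    exact propext (hY y).symm
  set φ : ℕ → ℚ := fun x => (p : ℚ) * T x - T p * x with hφ
  have hφp : Function.Periodic φ p := by
    intro x
    simp only [hφ, hTp]; push_cast; ring
  have h1 : InvRec (fun j => φ (U (j + N))) := by
    refine InvRec.periodic π hπ fun j => ?_
    have := hper (j + N) (by omega)
    rw [show j + π + N = j + N + π by ring, ← hφp.map_mod_nat, this, hφp.map_mod_nat]
  have h2 := (h1.add ((hU.shift N).smul (T p : ℚ))).smul ((p : ℚ)⁻¹)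
  convert h2 using 1
  funext j
  have : (p : ℚ) ≠ 0 := by exact_mod_cast hp.ne'
  simp only [Pi.smul_apply, Pi.add_apply, smul_eq_mul, hφ]
  field_simp
  ring

open Classical in
lemma count_Ico (Y : Set ℕ) (a b : ℕ) (h : a ≤ b) :
    (((Finset.Ico a b).filter (· ∈ Y)).card : ℚ) = Nat.count (· ∈ Y) b - Nat.count (· ∈ Y) a := by
  rw [eq_sub_iff_add_eq, Nat.count_eq_card_filter_range, Nat.count_eq_card_filter_range]
  norm_cast
  rw [add_comm, Finset.range_eq_Ico, Finset.range_eq_Ico,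
    ← Finset.Ico_union_Ico_eq_Ico (Nat.zero_le a) h, Finset.filter_union,
    Finset.card_union_of_disjoint]
  exact Finset.disjoint_filter_filter (Finset.Ico_disjoint_Ico_consecutive 0 a b)

/-- Let `U` be a linear numeration system and `X ⊆ ℕ` an ultimately periodic
`U`-recognizable set with minimal period `p_X` and minimal preperiod `a_X ≥ 1`.
Then every deterministic finite automaton over `A_U` accepting `rep_U(X)` has
at least `|rep_U(a_X - 1)| - ι_U(p_X)` states. -/
theorem statement_6 (U : ℕ → ℕ) (hmono : StrictMono U) (h0 : U 0 = 1)
    (hfin : ∃ C, ∀ i, U (i + 1) ≤ C * U i)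
    (k : ℕ) (hk : 0 < k) (a : Fin k → ℤ)
    (hak : a ⟨k - 1, Nat.sub_lt hk Nat.one_pos⟩ ≠ 0)
    (hrec : ∀ i : ℕ, (U (i + k) : ℤ) = ∑ j : Fin k, a j * U (i + k - 1 - (j : ℕ)))
    (X : Set ℕ) (hX : UltPeriodic X) (ha : 1 ≤ minPreperiod X)
    (σ : Type*) [Fintype σ] (M : DFA ℕ σ) (hM : M.accepts = repLang U X)
    (w : List ℕ) (hw : IsGreedyRep U (minPreperiod X - 1) w) :
    w.length - iotaU U (minPeriod X) ≤ Fintype.card σ := by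
  classical
  by_contra hcon
  push Not at hcon
  obtain ⟨a0, p0, hp0⟩ := hX
  have hpm : minPeriod X ∈ {p | ∃ a, IsPeriodPair X a p} := Nat.sInf_mem ⟨p0, a0, hp0⟩
  have ham : minPreperiod X ∈ {a | IsPeriodPair X a (minPeriod X)} := Nat.sInf_mem hpm
  have hmin : ∀ b, IsPeriodPair X b (minPeriod X) → minPreperiod X ≤ b := fun b hb => Nat.sInf_le hb
  revert ham hmin ha hw hcon
  generalize minPreperiod X = A
  generalize minPeriod X = p
  intro ha hw hcon ham hmin
  obtain ⟨hp, hper⟩ := ham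
  obtain ⟨π, hπ, hι⟩ := iota_spec U k hk a hrec p hp
  generalize iotaU U p = ι at *
  -- the periodic set
  have hperm : ∀ j n, A ≤ n → (n ∈ X ↔ n + j * p ∈ X) := by
    intro j n hn
    induction j with
    | zero => simp
    | succ j ih => rw [ih, hper _ (by omega), show n + j * p + p = n + (j + 1) * p by ring]
  let Y : Set ℕ := {n | n + A * p ∈ X}
  have hYX : ∀ n, A ≤ n → (n ∈ X ↔ n ∈ Y) := fun n hn => hperm A n hn
  have hYper : ∀ n, n ∈ Y ↔ n + p ∈ Y := by
    intro n
    show n + A * p ∈ X ↔ n + p + A * p ∈ X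
    rw [hper (n + A * p) (by nlinarith [Nat.zero_le n]), add_right_comm]
  have hYmod : ∀ m n, m ≡ n [MOD p] → (m ∈ Y ↔ n ∈ Y) := by
    have hmul : ∀ n j, n ∈ Y ↔ n + p * j ∈ Y := by
      intro n j
      induction j with
      | zero => simp
      | succ j ih => rw [ih, hYper, show n + p * j + p = n + p * (j + 1) by ring]
    intro m n hmn
    have e1 := hmul (m % p) (m / p)
    have e2 := hmul (n % p) (n / p)
    rw [Nat.mod_add_div] at e1 e2
    rw [← e1, ← e2, hmn]
  have hnot : ¬ (A - 1 ∈ X ↔ A - 1 ∈ Y) := by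
    intro h
    have := hmin (A - 1) ⟨hp, fun n hn => by
      rcases Nat.lt_or_ge n A with h1 | h1
      · have : n = A - 1 := by omega
        subst this
        rw [h, hYper, hYX _ (by omega)]
      · exact hper n h1⟩
    omega
  -- the length
  obtain ⟨g, hg⟩ : ∃ g, w.length = g + 1 := ⟨w.length - 1, by omega⟩
  have hrange := greedy_range h0 hw hg
  have hU := InvRec.linear U k hk a hak hrec
  have hcnt := count_block hmono h0 hfin X M hM
  -- cardinalities agree
  have hcard : ((Finset.Ico (U g) (U (g + 1))).filter (· ∈ X)).card
      = ((Finset.Ico (U g) (U (g + 1))).filter (· ∈ Y)).card := by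
    have i1 : InvRec (fun j => ((wordsFrom M (CU U) (j + (g + 1)) M.start).card : ℚ)) := by
      have := (InvRec.ofLinear (transfer M (CU U))
        (fun q => ((wordsFrom M (CU U) 0 q).card : ℚ)) M.start).shift (g + 1 - Fintype.card σ)
      convert this using 1
      funext j
      rw [show j + (g + 1 - Fintype.card σ) + Fintype.card σ = j + (g + 1) by omega,
        ← card_wordsFrom]
    have hT := count_periodic Y p hp hYper U hU π ι hπ hι
    have i2 := (hT.shift (g + 1 - ι)).sub (hT.shift (g - ι))
    have i3 := (i1.sub i2).zero_of ?_
    · have e := count_Ico Y (U g) (U (g + 1)) (hmono.monotone (by omega))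
      simp only [Pi.sub_apply, zero_add] at i3
      rw [show g + 1 - ι + ι = g + 1 by omega, show g - ι + ι = g by omega, ← e, hcnt] at i3
      have := sub_eq_zero.1 i3
      exact_mod_cast this
    · intro j hj
      have e := count_Ico Y (U (j + g)) (U (j + g + 1)) (hmono.monotone (by omega))
      simp only [Pi.sub_apply]
      rw [show j + (g + 1 - ι) + ι = j + g + 1 by omega, show j + (g - ι) + ι = j + g by omega,
        ← e, show j + (g + 1) = j + g + 1 by omega, hcnt, sub_eq_zero]
      congr 2
      refine Finset.filter_congr fun n hn => ?_
      rw [Finset.mem_Ico] at hn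
      have : U (g + 1) ≤ U (j + g) := hmono.monotone (by omega)
      exact hYX n (by omega)
  -- inclusion by pumping
  have hsub : (Finset.Ico (U g) (U (g + 1))).filter (· ∈ X)
      ⊆ (Finset.Ico (U g) (U (g + 1))).filter (· ∈ Y) := by
    intro n hn
    rw [Finset.mem_filter, Finset.mem_Ico] at hn ⊢
    refine ⟨hn.1, ?_⟩
    obtain ⟨v, hvl, hv⟩ := greedy_exists hmono h0 hfin g n hn.1.1 hn.1.2
    have hacc : v ∈ M.accepts := by rw [hM]; exact ⟨n, hn.2, hv⟩
    obtain ⟨x, y, z, hxyz, hlen, hy, hle⟩ := M.pumping_lemma hacc (by omega)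
    have hmem : (x ++ (y ++ (List.replicate (p * π) y).flatten)) ++ z ∈ M.accepts := by
      apply hle
      refine Language.append_mem_mul (Language.append_mem_mul rfl ?_) rfl
      rw [Language.mem_kstar]
      refine ⟨List.replicate (p * π + 1) y, by rw [List.replicate_succ, List.flatten_cons], ?_⟩
      intro u hu
      exact List.eq_of_mem_replicate hu
    have hl : v.length = x.length + y.length + z.length := by simp [hxyz, add_assoc]
    have hmod := pump_val hι (x ++ y) y z (by omega)
    rw [← hxyz, hv.1, List.append_assoc x y] at hmod
    rw [hM] at hmem
    obtain ⟨n2, hn2, hg2⟩ := hmem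
    rw [hg2.1] at hmod
    have hypos : 0 < y.length := List.length_pos_iff.2 hy
    have hlen2 : ∃ t, (x ++ (y ++ (List.replicate (p * π) y).flatten) ++ z).length = t + 1
        ∧ g + 1 ≤ t := by
      refine ⟨x.length + y.length + p * π * y.length + z.length - 1, ?_, ?_⟩
      · simp only [List.length_append, length_rep]; omega
      · have : 0 < p * π * y.length := by positivity
        omega
    obtain ⟨t, ht, htg⟩ := hlen2
    have hb := greedy_range h0 hg2 ht
    have : U (g + 1) ≤ U t := hmono.monotone htg
    exact (hYmod _ _ hmod).1 ((hYX n2 (by omega)).1 hn2)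
  have heq := Finset.eq_of_subset_of_card_le hsub hcard.ge
  apply hnot
  have : A - 1 ∈ (Finset.Ico (U g) (U (g + 1))).filter (· ∈ X) ↔
      A - 1 ∈ (Finset.Ico (U g) (U (g + 1))).filter (· ∈ Y) := by rw [heq]
  simpa only [Finset.mem_filter, Finset.mem_Ico, hrange, and_self, true_and] using this
end

section
/- Let a, b be nonnegative integers and let U = (U_i)_{i≥0} be a linear numeration system with digit alphabet A_U. Then the language val_U^{-1}(aℕ + b) = {w ∈ A_U^* : val_U(w) ∈ aℕ + b} of all words over A_U whose U-numerical value lies in the arithmetic progression aℕ + b is a regular language. -/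
/-- A language recognized by a right-congruent map of finite range is regular. -/
theorem regular_of_map {σ : Type*} (f : List ℕ → σ) (hfin : (Set.range f).Finite)
    (hstep : ∀ u v : List ℕ, f u = f v → ∀ d, f (u ++ [d]) = f (v ++ [d])) (S : Set σ) :
    Language.IsRegular ({w : List ℕ | f w ∈ S} : Language ℕ) := by
  have key : ∀ (y u v : List ℕ), f u = f v → f (u ++ y) = f (v ++ y) := by
    intro y
    induction y with
    | nil => intro u v h; simpa using h
    | cons d y ih =>
      intro u v h
      have := ih _ _ (hstep u v h d)
      simpa using this
  apply Language.IsRegular.of_finite_range_leftQuotient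
  let g : σ → Language ℕ := fun s => {y | ∃ u, f u = s ∧ f (u ++ y) ∈ S}
  apply (hfin.image g).subset
  rintro _ ⟨x, rfl⟩
  refine ⟨f x, ⟨x, rfl⟩, ?_⟩
  apply Set.ext
  intro y
  constructor
  · rintro ⟨u, hu, hS⟩
    change f (x ++ y) ∈ S
    rw [← key y u x hu]; exact hS
  · intro h
    exact ⟨x, rfl, h⟩

/-- Value, least significant digit first. -/
def valR (U : ℕ → ℕ) (w : List ℕ) : ℕ :=
  ∑ i ∈ Finset.range w.length, w.getD i 0 * U i

theorem valR_snoc (U : ℕ → ℕ) (w : List ℕ) (d : ℕ) :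
    valR U (w ++ [d]) = valR U w + d * U w.length := by
  unfold valR
  rw [List.length_append, List.length_singleton, Finset.sum_range_succ]
  congr 1
  · apply Finset.sum_congr rfl
    intro i hi
    rw [List.getD_append _ _ _ _ (Finset.mem_range.1 hi)]
  · simp

theorem core (U : ℕ → ℕ) (hmono : StrictMono U)
    (k : ℕ) (hk : 0 < k) (co : Fin k → ℤ)
    (hrec : ∀ i : ℕ, (U (i + k) : ℤ) = ∑ j : Fin k, co j * U (i + k - 1 - (j : ℕ)))
    (m : ℕ) (hm : 0 < m) (B C : ℕ) (S : ℕ → ZMod m → Prop) :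
    Language.IsRegular ({w : List ℕ | (∀ d ∈ w, d < C) ∧
      S (min (valR U w) B) (valR U w : ZMod m)} : Language ℕ) := by
  have : NeZero m := ⟨hm.ne'⟩
  let f : List ℕ → Prop × (Fin (B + 1) × (Fin (B + 1) × (ZMod m × (Fin k → ZMod m)))) := fun w =>
    (∀ d ∈ w, d < C, ⟨min w.length B, by omega⟩, ⟨min (valR U w) B, by omega⟩,
      (valR U w : ZMod m), fun j => (U (w.length + j) : ZMod m))
  have h := regular_of_map f (Set.toFinite _) ?_
    {s | s.1 ∧ S (s.2.2.1 : ℕ) s.2.2.2.1}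
  · exact h
  · intro u v huv d
    simp only [f, Prod.mk.injEq, Fin.mk.injEq, eq_iff_iff] at huv
    obtain ⟨h1, h2, h3, h4, h5⟩ := huv
    have h5' : ∀ j, j < k → (U (u.length + j) : ZMod m) = U (v.length + j) :=
      fun j hj => congrFun h5 ⟨j, hj⟩
    have hk' : (U (u.length + k) : ZMod m) = U (v.length + k) := by
      have e : ∀ i, (U (i + k) : ZMod m) =
          ∑ j : Fin k, (co j : ZMod m) * U (i + k - 1 - (j : ℕ)) := by
        intro i
        have := congrArg (Int.cast : ℤ → ZMod m) (hrec i)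
        push_cast at this
        exact this
      rw [e, e]
      apply Finset.sum_congr rfl
      intro j _
      have hj := j.2
      have := h5' (k - 1 - j) (by omega)
      rw [show u.length + k - 1 - (j : ℕ) = u.length + (k - 1 - j) by omega,
        show v.length + k - 1 - (j : ℕ) = v.length + (k - 1 - j) by omega, this]
    simp only [f, Prod.mk.injEq, Fin.mk.injEq, eq_iff_iff]
    refine ⟨?_, ?_, ?_, ?_, ?_⟩
    · simp only [List.mem_append, List.mem_singleton, or_imp, forall_and, forall_eq]
      rw [h1]
    · simp only [List.length_append, List.length_singleton]; omega
    · rw [valR_snoc, valR_snoc]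
      by_cases hl : u.length = v.length
      · rw [hl]; omega
      · have hu : B ≤ u.length := by omega
        have hv : B ≤ v.length := by omega
        have hu' := hmono.le_apply (x := u.length)
        have hv' := hmono.le_apply (x := v.length)
        rcases Nat.eq_zero_or_pos d with rfl | hd
        · simpa using h3
        · have := Nat.le_mul_of_pos_left (U u.length) hd
          have := Nat.le_mul_of_pos_left (U v.length) hd
          omega
    · rw [valR_snoc, valR_snoc]
      push_cast
      have := h5' 0 hk
      simp only [add_zero] at this
      rw [h4, this]
    · funext j
      simp only [List.length_append, List.length_singleton]
      rw [add_assoc, add_assoc]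
      rcases Nat.lt_or_ge (1 + (j : ℕ)) k with h | h
      · exact h5' _ h
      · have : 1 + (j : ℕ) = k := by have := j.2; omega
        rw [this]; exact hk'

theorem statement_7 (U : ℕ → ℕ) (hmono : StrictMono U) (h0 : U 0 = 1)
    (hfin : ∃ C, ∀ i, U (i + 1) ≤ C * U i)
    (k : ℕ) (hk : 0 < k) (co : Fin k → ℤ)
    (hak : co ⟨k - 1, Nat.sub_lt hk Nat.one_pos⟩ ≠ 0)
    (hrec : ∀ i : ℕ, (U (i + k) : ℤ) = ∑ j : Fin k, co j * U (i + k - 1 - (j : ℕ)))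
    (a b : ℕ) :
    Language.IsRegular
      ({w : List ℕ | (∀ d ∈ w, d < CU U) ∧ ∃ n : ℕ, valU U w = a * n + b} :
        Language ℕ) := by
  have hval : ∀ w, valU U w = valR U w.reverse := by
    intro w; simp [valU, valR]
  rcases Nat.eq_zero_or_pos a with rfl | ha
  · have h := (core U hmono k hk co hrec 1 one_pos (b + 1) (CU U) (fun x _ => x = b)).reverse
    refine (congrArg Language.IsRegular ?_).mpr h
    apply Set.ext
    intro w
    change ((∀ d ∈ w, d < CU U) ∧ ∃ n : ℕ, valU U w = 0 * n + b) ↔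
      ((∀ d ∈ w.reverse, d < CU U) ∧ min (valR U w.reverse) (b + 1) = b)
    rw [hval]
    simp only [List.mem_reverse, zero_mul, zero_add, exists_const]
    refine and_congr_right fun _ => ?_
    omega
  · have h := (core U hmono k hk co hrec a ha b (CU U) (fun x y => x = b ∧ y = b)).reverse
    refine (congrArg Language.IsRegular ?_).mpr h
    apply Set.ext
    intro w
    change ((∀ d ∈ w, d < CU U) ∧ ∃ n : ℕ, valU U w = a * n + b) ↔
      ((∀ d ∈ w.reverse, d < CU U) ∧ min (valR U w.reverse) b = b ∧
        (valR U w.reverse : ZMod a) = b)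
    rw [hval]
    simp only [List.mem_reverse]
    refine and_congr_right fun _ => ?_
    constructor
    · rintro ⟨n, hn⟩
      rw [hn]
      simp
    · rintro ⟨h1, h2⟩
      have hle : b ≤ valR U w.reverse := by omega
      rw [ZMod.natCast_eq_natCast_iff] at h2
      obtain ⟨n, hn⟩ := (Nat.modEq_iff_dvd' hle).1 h2.symm
      exact ⟨n, by omega⟩
end

section
/- Let U = (U_i)_{i≥0} be a strictly increasing sequence of positive integers satisfying a linear recurrence U_{i+k} = a_1 U_{i+k−1} + ⋯ + a_k U_i with integer coefficients and a_k ≠ 0, and suppose g := gcd(a_1, …, a_k) ≥ 2. Then for every n ≥ 1, the only residue taken infinitely often by the sequence (U_i mod g^n)_{i≥0} is 0; in particular N_U(g^n) = 1 for all n ≥ 1, so N_U(m) does not tend to +∞ as m → +∞. -/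
open Filter

/-- Let `U` be a strictly increasing sequence of positive integers satisfying a
linear recurrence `U_{i+k} = a_1 U_{i+k-1} + ⋯ + a_k U_i` with integer
coefficients and `a_k ≠ 0` (here `a ⟨j⟩` is the coefficient `a_{j+1}`), and
suppose `g := gcd(a_1, …, a_k) ≥ 2`.  Then for every `n ≥ 1` the only residue
taken infinitely often by `(U_i mod g^n)` is `0`; in particular
`N_U(g^n) = 1` for all `n ≥ 1`, so `N_U(m)` does not tend to `+∞`. -/
theorem statement_13 (U : ℕ → ℕ) (hmono : StrictMono U) (hpos : ∀ i, 0 < U i)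
    (k : ℕ) (hk : 0 < k) (a : Fin k → ℤ)
    (hak : a ⟨k - 1, Nat.sub_lt hk Nat.one_pos⟩ ≠ 0)
    (hrec : ∀ i : ℕ, (U (i + k) : ℤ) = ∑ j : Fin k, a j * U (i + k - 1 - (j : ℕ)))
    (g : ℕ) (hg : (g : ℤ) = Finset.univ.gcd a) (hg2 : 2 ≤ g) :
    (∀ n : ℕ, 1 ≤ n → ∀ r : ZMod (g ^ n),
      (∀ N : ℕ, ∃ i, N ≤ i ∧ (U i : ZMod (g ^ n)) = r) → r = 0) ∧
    (∀ n : ℕ, 1 ≤ n → Ninf U (g ^ n) = 1) ∧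
    ¬ Tendsto (fun m => Ninf U m) atTop atTop := by
  have hdvd : ∀ n : ℕ, ∀ i, n * k ≤ i → ((g : ℤ) ^ n) ∣ (U i : ℤ) := by
    intro n
    induction n with
    | zero => intro i _; simp
    | succ n ih =>
      intro i hi
      have hi' : n * k + k ≤ i := by rw [Nat.succ_mul] at hi; exact hi
      obtain ⟨t, rfl⟩ : ∃ t, i = t + k := ⟨i - k, by omega⟩
      rw [hrec t]
      apply Finset.dvd_sum
      intro j _
      rw [pow_succ, mul_comm]
      apply mul_dvd_mul
      · rw [hg]
        exact Finset.gcd_dvd (Finset.mem_univ j)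
      · apply ih
        have := j.isLt
        omega
  have hz : ∀ n : ℕ, ∀ i, n * k ≤ i → (U i : ZMod (g ^ n)) = 0 := by
    intro n i hi
    rw [ZMod.natCast_eq_zero_iff]
    exact_mod_cast hdvd n i hi
  have h1 : ∀ n : ℕ, 1 ≤ n → ∀ r : ZMod (g ^ n),
      (∀ N : ℕ, ∃ i, N ≤ i ∧ (U i : ZMod (g ^ n)) = r) → r = 0 := by
    intro n _ r hr
    obtain ⟨i, hi, h⟩ := hr (n * k)
    rw [← h, hz n i hi]
  have h2 : ∀ n : ℕ, 1 ≤ n → Ninf U (g ^ n) = 1 := by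
    intro n hn
    unfold Ninf
    rw [Set.ncard_eq_one]
    refine ⟨0, Set.eq_singleton_iff_unique_mem.2 ⟨?_, fun r hr => h1 n hn r hr⟩⟩
    intro N
    exact ⟨max N (n * k), le_max_left _ _, hz n _ (le_max_right _ _)⟩
  refine ⟨h1, h2, fun h => ?_⟩
  obtain ⟨M, hM⟩ := eventually_atTop.1 (h.eventually_ge_atTop 2)
  have hlt : M + 1 < g ^ (M + 1) := Nat.lt_pow_self (by omega)
  have h3 := hM (g ^ (M + 1)) (by omega)
  have h4 := h2 (M + 1) (by omega)
  omega
end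

section
/- Let U = (U_i)_{i≥0} be an integer sequence satisfying U_{i+k} = a_1 U_{i+k−1} + ⋯ + a_k U_i with integer coefficients and a_k ≠ 0, let P_U(x) = 1 − a_1 x − ⋯ − a_k x^k ∈ ℤ[x], and let p be a prime. Suppose P_U(x) = A(x)·B(x) with A(x), B(x) ∈ ℤ[x], B(x) ≡ 1 (mod pℤ[x]), and A(x) dividing x^d − 1 in ℤ[x] for some d ≥ 1. Then for every v ≥ 1 one has U_{i+d} ≡ U_i (mod p^v) for all sufficiently large i; in particular N_U(p^v) ≤ d for every v ≥ 1. -/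
open Filter Polynomial

/-- Let `U` be an integer sequence satisfying
`U_{i+k} = a_1 U_{i+k-1} + ⋯ + a_k U_i` with integer coefficients and
`a_k ≠ 0` (here `a ⟨j⟩` is the coefficient `a_{j+1}`), let
`P_U(x) = 1 - a_1 x - ⋯ - a_k x^k ∈ ℤ[x]`, and let `p` be a prime.  Suppose
`P_U = A·B` with `A, B ∈ ℤ[x]`, `B ≡ 1 (mod pℤ[x])`, and `A` dividing
`x^d - 1` in `ℤ[x]` for some `d ≥ 1`.  Then for every `v ≥ 1` one has
`U_{i+d} ≡ U_i (mod p^v)` for all sufficiently large `i`; in particular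
`N_U(p^v) ≤ d` for every `v ≥ 1`. -/
theorem statement_15 (U : ℕ → ℤ) (k : ℕ) (hk : 0 < k) (a : Fin k → ℤ)
    (hak : a ⟨k - 1, Nat.sub_lt hk Nat.one_pos⟩ ≠ 0)
    (hrec : ∀ i : ℕ, U (i + k) = ∑ j : Fin k, a j * U (i + k - 1 - (j : ℕ)))
    (p : ℕ) (hp : p.Prime)
    (P : Polynomial ℤ)
    (hP : P = 1 - ∑ j : Fin k, Polynomial.C (a j) * Polynomial.X ^ ((j : ℕ) + 1))
    (A B : Polynomial ℤ) (hAB : P = A * B)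
    (hB : B.map (Int.castRingHom (ZMod p)) = 1)
    (d : ℕ) (hd : 1 ≤ d) (hA : A ∣ (Polynomial.X ^ d - 1)) :
    ∀ v : ℕ, 1 ≤ v →
      (∃ N : ℕ, ∀ i, N ≤ i → U (i + d) ≡ U i [ZMOD ((p : ℤ) ^ v)]) ∧
      NinfZ U (p ^ v) ≤ d := by
  intro v hv
  have key : ∃ N : ℕ, ∀ i, N ≤ i → U (i + d) ≡ U i [ZMOD ((p : ℤ) ^ v)] := by
    obtain ⟨Q, hQ⟩ := hA
    have hC : ∃ C : Polynomial ℤ, B = 1 - Polynomial.C (p : ℤ) * C := by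
      have h1 : Polynomial.C (p : ℤ) ∣ 1 - B := by
        rw [Polynomial.C_dvd_iff_dvd_coeff]
        intro n
        have h2 := congrArg (fun q => Polynomial.coeff q n) hB
        simp only [Polynomial.coeff_map, eq_intCast, Polynomial.coeff_one] at h2
        rw [← CharP.intCast_eq_zero_iff (ZMod p) p, Polynomial.coeff_sub, Polynomial.coeff_one,
          Int.cast_sub, h2]
        split_ifs <;> simp
      obtain ⟨C, hC⟩ := h1
      exact ⟨C, by rw [← hC]; ring⟩
    obtain ⟨C, hC⟩ := hC
    set T : Polynomial ℤ := Polynomial.C (p : ℤ) * C with hT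
    have hG : B * (∑ j ∈ Finset.range v, T ^ j) = 1 - T ^ v := by
      rw [hC]; exact mul_neg_geom_sum T v
    set G := ∑ j ∈ Finset.range v, T ^ j
    set F : PowerSeries ℤ := PowerSeries.mk U with hF
    have hPF : ∀ n, k ≤ n → PowerSeries.coeff n ((P : PowerSeries ℤ) * F) = 0 := by
      intro n hn
      obtain ⟨i, rfl⟩ := Nat.exists_eq_add_of_le' hn
      have e : (P : PowerSeries ℤ) = 1 - ∑ j : Fin k, PowerSeries.C (a j) * PowerSeries.X ^ ((j : ℕ) + 1) := by
        rw [hP]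
        have := map_sum (Polynomial.coeToPowerSeries.ringHom (R := ℤ))
          (fun j : Fin k => Polynomial.C (a j) * Polynomial.X ^ ((j : ℕ) + 1)) Finset.univ
        simp only [Polynomial.coeToPowerSeries.ringHom_apply] at this
        rw [Polynomial.coe_sub, this]
        simp only [Polynomial.coe_mul, Polynomial.coe_pow, Polynomial.coe_one, Polynomial.coe_X,
          Polynomial.coe_C]
      rw [e, sub_mul, one_mul, Finset.sum_mul, map_sub, map_sum, hF, PowerSeries.coeff_mk, hrec i,
        sub_eq_zero]
      refine Finset.sum_congr rfl fun j _ => ?_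
      have hj := j.2
      rw [mul_assoc, PowerSeries.coeff_C_mul, PowerSeries.coeff_X_pow_mul', if_pos (by omega),
        PowerSeries.coeff_mk]
      congr 2
      omega
    set R := PowerSeries.trunc k ((P : PowerSeries ℤ) * F) with hR
    have hRe : (R : PowerSeries ℤ) = (P : PowerSeries ℤ) * F := by
      ext n
      rw [Polynomial.coeff_coe, hR, PowerSeries.coeff_trunc]
      split_ifs with h
      · rfl
      · exact (hPF n (by omega)).symm
    have hpoly : (X ^ d - 1 : Polynomial ℤ) * (1 - T ^ v) = Q * G * P := by
      rw [← hG, hQ, hAB]; ring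
    have hmain : ((X ^ d - 1 : Polynomial ℤ) : PowerSeries ℤ) * F
        = ((Q * G * R : Polynomial ℤ) : PowerSeries ℤ) +
          PowerSeries.C ((p : ℤ) ^ v) * ((((X ^ d - 1) * C ^ v : Polynomial ℤ) : PowerSeries ℤ) * F) := by
      have h3 := congrArg (fun q : Polynomial ℤ => (q : PowerSeries ℤ) * F) hpoly
      simp only [hT, mul_pow, Polynomial.coe_mul, Polynomial.coe_sub, Polynomial.coe_pow, Polynomial.coe_one, Polynomial.coe_X, Polynomial.coe_C, hRe, map_pow] at h3 ⊢
      linear_combination h3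
    refine ⟨(Q * G * R).natDegree + 1, fun i hi => ?_⟩
    have h4 := congrArg (PowerSeries.coeff (i + d)) hmain
    rw [map_add, Polynomial.coeff_coe, Polynomial.coeff_eq_zero_of_natDegree_lt (by omega),
      PowerSeries.coeff_C_mul, Polynomial.coe_sub, Polynomial.coe_pow, Polynomial.coe_X,
      Polynomial.coe_one, sub_mul, one_mul, map_sub, PowerSeries.coeff_X_pow_mul, hF,
      PowerSeries.coeff_mk, PowerSeries.coeff_mk, zero_add] at h4
    rw [Int.modEq_iff_dvd]
    exact ⟨_, h4⟩
  refine ⟨key, ?_⟩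
  obtain ⟨N, hN⟩ := key
  have hper : ∀ q r : ℕ, (U (N + r + d * q) : ZMod (p ^ v)) = U (N + r) := by
    intro q r
    induction q with
    | zero => simp
    | succ q ih =>
      rw [← ih, ZMod.intCast_eq_intCast_iff, Nat.mul_succ, ← add_assoc]
      push_cast
      exact hN _ (by omega)
  have hsub : {r : ZMod (p ^ v) | ∀ N : ℕ, ∃ i, N ≤ i ∧ (U i : ZMod (p ^ v)) = r} ⊆
      ((Finset.range d).image (fun r => (U (N + r) : ZMod (p ^ v))) : Finset _) := by
    intro r hr
    obtain ⟨i, hi, rfl⟩ := hr N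
    rw [Finset.mem_coe, Finset.mem_image]
    refine ⟨(i - N) % d, Finset.mem_range.2 (Nat.mod_lt _ hd), ?_⟩
    rw [← hper ((i - N) / d)]
    congr 2
    have := Nat.mod_add_div (i - N) d
    omega
  refine (Set.ncard_le_ncard hsub (Finset.finite_toSet _)).trans ?_
  rw [Set.ncard_coe_finset]
  exact Finset.card_image_le.trans (by simp)
end

section
/- Let S = (L, Σ, <) be an abstract numeration system with minimal automaton M_L = (Q_L, q_{0,L}, Σ, δ_L, F_L) of L. If X ⊆ ℕ is an ultimately periodic set with minimal period p_X and minimal preperiod a_X ≥ 1 such that rep_S(X) is accepted by a deterministic finite automaton with d states, then |rep_S(a_X − 1)| ≤ d·#Q_L + I(p_X), where I(p_X) := max_{q ∈ Q_L} ι_{u(q)}(p_X) and ι_{u(q)}(p_X) is the minimal preperiod of the ultimately periodic sequence (u_i(q) mod p_X)_{i≥0}. In particular, the preperiod a_X is bounded by an effectively computable constant depending only on S, d and p_X. -/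
open Filter

/-- `u_i(q)`: the number of words of length `i` accepted from the state `q` in
the automaton `M`. -/
noncomputable def uCount {A Q : Type*} (M : DFA A Q) (q : Q) (i : ℕ) : ℕ :=
  Set.ncard {w : List A | w.length = i ∧ M.evalFrom q w ∈ M.accept}

/-- `v_i(q)`: the number of words of length `≤ i` accepted from the state `q`
in the automaton `M`. -/
noncomputable def vCount {A Q : Type*} (M : DFA A Q) (q : Q) (i : ℕ) : ℕ :=
  Set.ncard {w : List A | w.length ≤ i ∧ M.evalFrom q w ∈ M.accept}

/-- The genealogical (radix/shortlex) strict order on words: first by length,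
then lexicographically. -/
def Shortlex {A : Type*} [LinearOrder A] (w w' : List A) : Prop :=
  w.length < w'.length ∨ (w.length = w'.length ∧ List.Lex (· < ·) w w')

section Aux

theorem aux_seq_iter (s : ℕ → ℕ) (N T : ℕ) (h : ∀ i, N ≤ i → s (i + T) = s i) (k i : ℕ)
    (hi : N ≤ i) : s (i + T * k) = s i := by
  induction k with
  | zero => simp
  | succ k ih =>
    rw [Nat.mul_succ, ← add_assoc, h _ (by omega), ih]

theorem aux_lex_asymm {A : Type*} [LinearOrder A] :
    ∀ v w : List A, List.Lex (· < ·) v w → ¬ List.Lex (· < ·) w v := by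
  intro v w h
  induction h with
  | nil => intro h; cases h
  | cons h ih =>
    intro h'
    cases h' with
    | cons h' => exact ih h'
    | rel h' => exact lt_irrefl _ h'
  | rel h =>
    intro h'
    cases h' with
    | cons h' => exact lt_irrefl _ h
    | rel h' => exact lt_asymm h h'

theorem aux_shortlex_asymm {A : Type*} [LinearOrder A] (v w : List A) (h : Shortlex v w) :
    ¬ Shortlex w v := by
  rintro (h' | ⟨h1, h2⟩) <;> rcases h with h | ⟨h3, h4⟩
  · omega
  · omega
  · omega
  · exact aux_lex_asymm _ _ h4 h2

theorem aux_ncard_cons {A : Type*} [DecidableEq A] (s : Finset A) (S : A → Set (List A))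
    (hS : ∀ a, (S a).Finite) :
    {w : List A | ∃ a ∈ s, ∃ v ∈ S a, w = a :: v}.Finite ∧
    Set.ncard {w : List A | ∃ a ∈ s, ∃ v ∈ S a, w = a :: v} = ∑ a ∈ s, (S a).ncard := by
  induction s using Finset.induction_on with
  | empty => simp
  | insert b s hb ih =>
    have e : {w : List A | ∃ a ∈ insert b s, ∃ v ∈ S a, w = a :: v}
        = (List.cons b '' S b) ∪ {w : List A | ∃ a ∈ s, ∃ v ∈ S a, w = a :: v} := by
      ext w
      simp only [Finset.mem_insert, Set.mem_ofPred_eq, Set.mem_union, Set.mem_image]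
      constructor
      · rintro ⟨a, rfl | ha, v, hv, rfl⟩
        · exact Or.inl ⟨v, hv, rfl⟩
        · exact Or.inr ⟨a, ha, v, hv, rfl⟩
      · rintro (⟨v, hv, rfl⟩ | ⟨a, ha, v, hv, rfl⟩)
        · exact ⟨b, Or.inl rfl, v, hv, rfl⟩
        · exact ⟨a, Or.inr ha, v, hv, rfl⟩
    have hf := (hS b).image (List.cons b)
    rw [e]
    refine ⟨hf.union ih.1, ?_⟩
    rw [Set.ncard_union_eq _ hf ih.1, Finset.sum_insert hb, ih.2,
      Set.ncard_image_of_injective _ (List.cons_injective)]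
    rw [Set.disjoint_left]
    rintro w ⟨v, hv, rfl⟩ ⟨a, ha, v', hv', h⟩
    simp only [List.cons.injEq] at h
    exact hb (h.1 ▸ ha)

variable {A : Type*} {Q : Type*}

theorem aux_finU [Fintype A] (M : DFA A Q) (q : Q) (i : ℕ) :
    {w : List A | w.length = i ∧ M.evalFrom q w ∈ M.accept}.Finite :=
  (List.finite_length_eq A i).subset fun _ h => h.1

theorem aux_u_succ [Fintype A] [LinearOrder A] (M : DFA A Q) (q : Q) (i : ℕ) :
    uCount M q (i + 1) = ∑ a, uCount M (M.step q a) i := by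
  unfold uCount
  rw [← (aux_ncard_cons Finset.univ _ (fun a => aux_finU M (M.step q a) i)).2]
  congr 1
  ext w
  cases w with
  | nil => simp
  | cons b w => simp

/-- contribution of the prefix `w` followed by `m` letters to the rank -/
noncomputable def auxP [Fintype A] [LinearOrder A] (M : DFA A Q) : Q → List A → ℕ → ℕ
  | _, [], _ => 0
  | q, b :: w, m => (∑ a ∈ Finset.univ.filter (· < b), uCount M (M.step q a) (w.length + m))
      + auxP M (M.step q b) w m

theorem auxP_append [Fintype A] [LinearOrder A] (M : DFA A Q) (x z : List A) (q : Q) (m : ℕ) :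
    auxP M q (x ++ z) m = auxP M q x (z.length + m) + auxP M (M.evalFrom q x) z m := by
  induction x generalizing q with
  | nil => simp [auxP]
  | cons b x ih => simp [auxP, ih, add_assoc]

theorem aux_lex_count [Fintype A] [LinearOrder A] (M : DFA A Q) (w : List A) (q : Q) :
    Set.ncard {v : List A | (v.length = w.length ∧ M.evalFrom q v ∈ M.accept) ∧
      List.Lex (· < ·) v w} = auxP M q w 0 := by
  induction w generalizing q with
  | nil =>
    simp only [auxP]
    rw [Set.ncard_eq_zero ((aux_finU M q _).subset fun _ h => h.1)]
    ext v
    simp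
  | cons b w ih =>
    have e : {v : List A | (v.length = (b :: w).length ∧ M.evalFrom q v ∈ M.accept) ∧
      List.Lex (· < ·) v (b :: w)} =
      {v : List A | ∃ a ∈ Finset.univ.filter (· < b),
        ∃ v' ∈ {v' : List A | v'.length = w.length ∧ M.evalFrom (M.step q a) v' ∈ M.accept},
          v = a :: v'} ∪
      List.cons b '' {v : List A | (v.length = w.length ∧ M.evalFrom (M.step q b) v ∈ M.accept) ∧
      List.Lex (· < ·) v w} := by
      ext v
      cases v with
      | nil => simp
      | cons c v =>
        simp only [Set.mem_ofPred_eq, Set.mem_union, Set.mem_image, Finset.mem_filter,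
          Finset.mem_univ, true_and, List.length_cons, add_left_inj, DFA.evalFrom_cons,
          List.cons.injEq]
        constructor
        · rintro ⟨⟨h1, h2⟩, h⟩
          cases h with
          | cons h => exact Or.inr ⟨v, ⟨⟨h1, h2⟩, h⟩, rfl, rfl⟩
          | rel h => exact Or.inl ⟨c, h, v, ⟨h1, h2⟩, rfl, rfl⟩
        · rintro (⟨a, h, v', ⟨h1, h2⟩, rfl, rfl⟩ | ⟨v', ⟨⟨h1, h2⟩, h⟩, rfl, rfl⟩)
          · exact ⟨⟨h1, h2⟩, List.Lex.rel h⟩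
          · exact ⟨⟨h1, h2⟩, List.Lex.cons h⟩
    have hc := aux_ncard_cons (Finset.univ.filter (· < b)) _
      (fun a => aux_finU M (M.step q a) w.length)
    have hf : {v : List A | (v.length = w.length ∧ M.evalFrom (M.step q b) v ∈ M.accept) ∧
      List.Lex (· < ·) v w}.Finite := (aux_finU M (M.step q b) _).subset fun _ h => h.1
    rw [e, Set.ncard_union_eq _ hc.1 (hf.image _), hc.2,
      Set.ncard_image_of_injective _ List.cons_injective, ih]
    · simp [auxP, uCount]
    · rw [Set.disjoint_left]
      rintro v ⟨a, ha, v', hv', rfl⟩ ⟨v, hv, h⟩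
      simp only [List.cons.injEq] at h
      simp [h.1] at ha

theorem aux_short_count [Fintype A] (M : DFA A Q) (q : Q) (n : ℕ) :
    Set.ncard {v : List A | v.length < n ∧ M.evalFrom q v ∈ M.accept}
      = ∑ i ∈ Finset.range n, uCount M q i := by
  induction n with
  | zero => simp
  | succ n ih =>
    have e : {v : List A | v.length < n + 1 ∧ M.evalFrom q v ∈ M.accept} =
      {v : List A | v.length < n ∧ M.evalFrom q v ∈ M.accept} ∪
      {v : List A | v.length = n ∧ M.evalFrom q v ∈ M.accept} := by
      ext v
      simp only [Set.mem_ofPred_eq, Set.mem_union, Nat.lt_succ_iff_lt_or_eq, or_and_right]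
    rw [e, Set.ncard_union_eq _ ((List.finite_length_lt A n).subset fun _ h => h.1)
      (aux_finU M q n), ih, Finset.sum_range_succ, uCount]
    rw [Set.disjoint_left]
    rintro v ⟨h1, -⟩ ⟨h2, -⟩
    omega

theorem aux_rank [Fintype A] [LinearOrder A] (M : DFA A Q) (rep : ℕ → List A)
    (hrep_mem : ∀ n : ℕ, rep n ∈ M.accepts)
    (hrep_surj : ∀ w ∈ M.accepts, ∃ n : ℕ, rep n = w)
    (hrep_mono : ∀ m n : ℕ, m < n → Shortlex (rep m) (rep n)) (n : ℕ) :
    n = ∑ i ∈ Finset.range (rep n).length, uCount M M.start i + auxP M M.start (rep n) 0 := by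
  have hinj : Function.Injective rep := by
    intro m k h
    by_contra hne
    rcases lt_or_gt_of_ne hne with h' | h'
    · have := hrep_mono _ _ h'
      rw [h] at this
      exact aux_shortlex_asymm _ _ this this
    · have := hrep_mono _ _ h'
      rw [h] at this
      exact aux_shortlex_asymm _ _ this this
  have e : rep '' (Set.Iio n) =
      {v : List A | v.length < (rep n).length ∧ M.evalFrom M.start v ∈ M.accept} ∪
      {v : List A | (v.length = (rep n).length ∧ M.evalFrom M.start v ∈ M.accept) ∧
      List.Lex (· < ·) v (rep n)} := by
    ext v
    simp only [Set.mem_image, Set.mem_Iio, Set.mem_union, Set.mem_ofPred_eq]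
    constructor
    · rintro ⟨m, hm, rfl⟩
      rcases hrep_mono _ _ hm with h | ⟨h1, h2⟩
      · exact Or.inl ⟨h, hrep_mem m⟩
      · exact Or.inr ⟨⟨h1, hrep_mem m⟩, h2⟩
    · intro h
      have hv : v ∈ M.accepts := by
        rcases h with h | h
        · exact h.2
        · exact h.1.2
      have hs : Shortlex v (rep n) := by
        rcases h with h | h
        · exact Or.inl h.1
        · exact Or.inr ⟨h.1.1, h.2⟩
      obtain ⟨m, rfl⟩ := hrep_surj v hv
      refine ⟨m, ?_, rfl⟩
      by_contra hmn
      rcases (not_lt.mp hmn).lt_or_eq with h' | h'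
      · exact aux_shortlex_asymm _ _ hs (hrep_mono _ _ h')
      · subst h'
        exact aux_shortlex_asymm _ _ hs hs
  have h1 : (rep '' (Set.Iio n)).ncard = n := by
    rw [Set.ncard_image_of_injective _ hinj, ← Finset.coe_Iio, Set.ncard_coe_finset]
    simp
  rw [e, Set.ncard_union_eq _ ((List.finite_length_lt A _).subset fun _ h => h.1)
    ((aux_finU M M.start _).subset fun _ h => h.1), aux_short_count, aux_lex_count] at h1
  · exact h1.symm
  · rw [Set.disjoint_left]
    rintro v ⟨h1, -⟩ ⟨⟨h2, -⟩, -⟩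
    omega

/-- the sequences `u_i(q) mod p` are ultimately periodic -/
theorem aux_u_per [Fintype A] [LinearOrder A] [Fintype Q] (M : DFA A Q) (p : ℕ) (hp : 0 < p) :
    ∃ T N : ℕ, 0 < T ∧ ∀ q i, N ≤ i → uCount M q (i + T) % p = uCount M q i % p := by
  have : NeZero p := ⟨hp.ne'⟩
  obtain ⟨m, n, hmn, h⟩ := Finite.exists_ne_map_eq_of_infinite
    (fun i : ℕ => fun q : Q => (uCount M q i : ZMod p))
  wlog hlt : m < n generalizing m n
  · exact this n m hmn.symm h.symm (by omega)
  have key : ∀ k q, (uCount M q (n + k) : ZMod p) = uCount M q (m + k) := by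
    intro k
    induction k with
    | zero => intro q; exact (congrFun h q).symm
    | succ k ih =>
      intro q
      rw [← add_assoc, ← add_assoc, aux_u_succ, aux_u_succ]
      push_cast
      exact Finset.sum_congr rfl fun a _ => ih _
  refine ⟨n - m, m, by omega, fun q i hi => ?_⟩
  have := key (i - m) q
  rw [show n + (i - m) = i + (n - m) by omega, show m + (i - m) = i by omega] at this
  exact (ZMod.natCast_eq_natCast_iff' _ _ _).mp this

theorem aux_seq_spec (s : ℕ → ℕ) (h : ∃ T N : ℕ, 0 < T ∧ ∀ i, N ≤ i → s (i + T) = s i) :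
    0 < seqMinPeriod s ∧ ∀ i, seqMinPreperiod s ≤ i → s (i + seqMinPeriod s) = s i := by
  obtain ⟨T, N, hT, hN⟩ := h
  have h1 : seqMinPeriod s ∈ {p : ℕ | 0 < p ∧ ∃ N : ℕ, ∀ i, N ≤ i → s (i + p) = s i} :=
    Nat.sInf_mem ⟨T, hT, N, hN⟩
  have h2 : seqMinPreperiod s ∈ {N : ℕ | ∀ i, N ≤ i → s (i + seqMinPeriod s) = s i} :=
    Nat.sInf_mem h1.2
  exact ⟨h1.1, h2⟩

theorem aux_common_period [Fintype A] [LinearOrder A] [Fintype Q] (M : DFA A Q) (p : ℕ)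
    (hp : 0 < p) : ∃ T : ℕ, 0 < T ∧ ∀ q i k,
      Finset.univ.sup (fun q : Q => seqMinPreperiod (fun i => uCount M q i % p)) ≤ i →
      (uCount M q (i + T * k) : ZMod p) = uCount M q i := by
  obtain ⟨T, N, hT, hN⟩ := aux_u_per M p hp
  have spec := fun q => aux_seq_spec (fun i => uCount M q i % p) ⟨T, N, hT, hN q⟩
  refine ⟨∏ q : Q, seqMinPeriod (fun i => uCount M q i % p),
    Finset.prod_pos fun q _ => (spec q).1, fun q i k hi => ?_⟩
  have hq : seqMinPreperiod (fun i => uCount M q i % p) ≤ i :=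
    le_trans (Finset.le_sup (f := fun q : Q => seqMinPreperiod (fun i => uCount M q i % p))
      (Finset.mem_univ q)) hi
  obtain ⟨c, hc⟩ := Finset.dvd_prod_of_mem
    (fun q : Q => seqMinPeriod (fun i => uCount M q i % p)) (Finset.mem_univ q)
  rw [hc, mul_assoc]
  exact (ZMod.natCast_eq_natCast_iff' _ _ _).mpr
    (aux_seq_iter (fun i => uCount M q i % p) _ _ (spec q).2 (c * k) i hq)

theorem auxP_per [Fintype A] [LinearOrder A] (M : DFA A Q) (p T I : ℕ)
    (h : ∀ q i k, I ≤ i → (uCount M q (i + T * k) : ZMod p) = uCount M q i)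
    (x : List A) (q : Q) (m k : ℕ) (hm : I ≤ m) :
    (auxP M q x (m + T * k) : ZMod p) = auxP M q x m := by
  induction x generalizing q with
  | nil => simp [auxP]
  | cons b x ih =>
    simp only [auxP, Nat.cast_add, ih, Nat.cast_sum, ← add_assoc]
    congr 1
    exact Finset.sum_congr rfl fun a _ => h _ _ _ (by omega)

theorem auxP_pow [Fintype A] [LinearOrder A] (M : DFA A Q) (y z : List A) (q : Q)
    (hq : M.evalFrom q y = q) (k : ℕ) :
    auxP M q ((List.replicate k y).flatten ++ z) 0 =
      ∑ c ∈ Finset.range k, auxP M q y (z.length + c * y.length) + auxP M q z 0 := by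
  induction k with
  | zero => simp
  | succ k ih =>
    rw [List.replicate_succ, List.flatten_cons, List.append_assoc, auxP_append, hq, ih,
      Finset.sum_range_succ]
    simp only [List.length_append, List.length_flatten, List.map_replicate, List.sum_replicate,
      smul_eq_mul, add_zero]
    rw [add_comm (k * y.length)]
    ring

theorem aux_sum_block (p T N : ℕ) (f : ℕ → ZMod p) (h : ∀ i k, N ≤ i → f (i + T * k) = f i)
    (m : ℕ) :
    ∑ i ∈ Finset.range (N + T * (p * m)), f i = ∑ i ∈ Finset.range N, f i := by
  have key : ∀ r, ∑ i ∈ Finset.range (N + T * r), f i =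
      ∑ i ∈ Finset.range N, f i + r * ∑ j ∈ Finset.range T, f (N + j) := by
    intro r
    induction r with
    | zero => simp
    | succ r ih =>
      rw [Nat.mul_succ, ← add_assoc, Finset.sum_range_add, ih]
      have : ∀ j ∈ Finset.range T, f (N + T * r + j) = f (N + j) := fun j _ => by
        rw [show N + T * r + j = (N + j) + T * r by ring, h _ _ (by omega)]
      rw [Finset.sum_congr rfl this]
      push_cast
      ring
  rw [key]
  simp

theorem aux_eval_pow {σ : Type*} (M : DFA A σ) (q : σ) (y : List A) (h : M.evalFrom q y = q)
    (k : ℕ) : M.evalFrom q (List.replicate k y).flatten = q := by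
  induction k with
  | zero => simp
  | succ k ih => rw [List.replicate_succ, List.flatten_cons, DFA.evalFrom_of_append, h, ih]

theorem aux_split {σ : Type*} [Fintype Q] [Fintype σ] (M : DFA A Q) (B : DFA A σ) (w : List A)
    (hw : Fintype.card σ * Fintype.card Q ≤ w.length) :
    ∃ x y z, w = x ++ y ++ z ∧ x.length + y.length ≤ Fintype.card σ * Fintype.card Q ∧ y ≠ [] ∧
      M.evalFrom (M.eval x) y = M.eval x ∧ B.evalFrom (B.eval x) y = B.eval x := by
  let D : DFA A (σ × Q) := ⟨fun s a => (B.step s.1 a, M.step s.2 a), (B.start, M.start), ∅⟩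
  have hD : ∀ (v : List A) s, D.evalFrom s v = (B.evalFrom s.1 v, M.evalFrom s.2 v) := by
    intro v
    induction v with
    | nil => intro s; rfl
    | cons a v ih => intro s; simp only [DFA.evalFrom_cons, ih]; rfl
  obtain ⟨q, x, y, z, h1, h2, h3, h4, h5, -⟩ :=
    D.evalFrom_split (x := w) (s := D.start) (t := D.evalFrom D.start w)
      (by rw [Fintype.card_prod]; exact hw) rfl
  rw [Fintype.card_prod] at h2
  subst h4
  rw [hD, hD] at h5
  exact ⟨x, y, z, h1, h2, h3, congrArg Prod.snd h5, congrArg Prod.fst h5⟩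

end Aux

/-- Let `S = (L, Σ, <)` be an abstract numeration system whose minimal
automaton of `L` is `M` (with set of states `Q`), and let `rep : ℕ → L` be the
genealogical enumeration of `L`.  If `X ⊆ ℕ` is ultimately periodic with
minimal period `p_X` and minimal preperiod `a_X ≥ 1`, and `rep_S(X)` is
accepted by a deterministic finite automaton with `d` states, then
`|rep_S(a_X - 1)| ≤ d·#Q + I(p_X)`, where
`I(p_X) = max_{q ∈ Q} ι_{u(q)}(p_X)` and `ι_{u(q)}(p_X)` is the minimal
preperiod of the ultimately periodic sequence `(u_i(q) mod p_X)_{i≥0}`. -/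
theorem statement_18 (A : Type*) [Fintype A] [LinearOrder A]
    (Q : Type*) [Fintype Q] (M : DFA A Q)
    (hinf : {w : List A | w ∈ M.accepts}.Infinite)
    (hreach : ∀ q : Q, ∃ w : List A, M.eval w = q)
    (hmin : ∀ q q' : Q,
      (∀ w : List A, (M.evalFrom q w ∈ M.accept ↔ M.evalFrom q' w ∈ M.accept)) → q = q')
    (rep : ℕ → List A)
    (hrep_mem : ∀ n : ℕ, rep n ∈ M.accepts)
    (hrep_surj : ∀ w ∈ M.accepts, ∃ n : ℕ, rep n = w)
    (hrep_mono : ∀ m n : ℕ, m < n → Shortlex (rep m) (rep n))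
    (X : Set ℕ) (hX : UltPeriodic X) (ha : 1 ≤ minPreperiod X)
    (σ : Type*) [Fintype σ] (d : ℕ) (hd : Fintype.card σ = d)
    (B : DFA A σ) (hB : B.accepts = {w : List A | ∃ n ∈ X, rep n = w}) :
    (rep (minPreperiod X - 1)).length ≤
      d * Fintype.card Q +
        Finset.univ.sup
          (fun q : Q => seqMinPreperiod (fun i => uCount M q i % minPeriod X)) := by
  by_contra hlen
  rw [not_le] at hlen
  obtain ⟨a0, p0, h0⟩ := hX
  have hP : ∃ a, IsPeriodPair X a (minPeriod X) :=
    Nat.sInf_mem (s := {p | ∃ a, IsPeriodPair X a p}) ⟨p0, a0, h0⟩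
  have hA : IsPeriodPair X (minPreperiod X) (minPeriod X) :=
    Nat.sInf_mem (s := {a | IsPeriodPair X a (minPeriod X)}) hP
  have hle : ∀ a, IsPeriodPair X a (minPeriod X) → minPreperiod X ≤ a := fun a h => Nat.sInf_le h
  generalize minPreperiod X = a at *
  generalize minPeriod X = p at *
  obtain ⟨hp, hper⟩ := hA
  obtain ⟨T, hT, hTper⟩ := aux_common_period M p hp
  generalize Finset.univ.sup (fun q : Q => seqMinPreperiod (fun i => uCount M q i % p)) = I at *
  have hrank := aux_rank M rep hrep_mem hrep_surj hrep_mono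
  have hinj : Function.Injective rep := fun m k h => by rw [hrank m, hrank k, h]
  have hXB : ∀ n, n ∈ X ↔ rep n ∈ B.accepts := by
    intro n
    rw [hB]
    constructor
    · intro h; exact ⟨n, h, rfl⟩
    · rintro ⟨m, hm, h⟩
      rwa [← hinj h]
  obtain ⟨x, y, z, hw, hxy, hy, hMy, hBy⟩ := aux_split M B (rep (a - 1)) (by rw [hd]; omega)
  rw [hd] at hxy
  have hz : I ≤ z.length := by
    have := congrArg List.length hw
    simp only [List.length_append] at this
    omega
  have hy0 : 0 < y.length := List.length_pos_iff.mpr hy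
  have hTp : 0 < T * p := Nat.mul_pos hT hp
  -- the pumped word
  have hMev : ∀ k, M.eval (x ++ ((List.replicate k y).flatten ++ z))
      = M.evalFrom (M.eval x) z := fun k => by
    rw [DFA.eval, DFA.evalFrom_of_append, DFA.evalFrom_of_append, ← DFA.eval,
      aux_eval_pow M _ y hMy]
  have hBev : ∀ k, B.eval (x ++ ((List.replicate k y).flatten ++ z))
      = B.evalFrom (B.eval x) z := fun k => by
    rw [DFA.eval, DFA.evalFrom_of_append, DFA.evalFrom_of_append, ← DFA.eval,
      aux_eval_pow B _ y hBy]
  have hw1 : rep (a - 1) = x ++ ((List.replicate 1 y).flatten ++ z) := by simp [hw]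
  obtain ⟨n, hn⟩ := hrep_surj (x ++ ((List.replicate (1 + T * p) y).flatten ++ z)) (by
    have := hrep_mem (a - 1)
    rw [hw1, DFA.mem_accepts, hMev] at this
    rw [DFA.mem_accepts, hMev]
    exact this)
  have hXn : a - 1 ∈ X ↔ n ∈ X := by
    rw [hXB, hXB, hw1, hn, DFA.mem_accepts, DFA.mem_accepts, hBev, hBev]
  have hlk : ∀ k, (x ++ ((List.replicate k y).flatten ++ z)).length
      = x.length + (k * y.length + z.length) := fun k => by simp
  have hlt : a - 1 < n := by
    by_contra hcon
    have hl : (rep (a - 1)).length < (rep n).length := by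
      rw [hw1, hn, hlk, hlk]
      nlinarith
    rcases (not_lt.mp hcon).lt_or_eq with h | h
    · rcases hrep_mono _ _ h with h | h
      · omega
      · omega
    · rw [h] at hl
      omega
  have hcong : (n : ZMod p) = ((a - 1 : ℕ) : ZMod p) := by
    rw [hrank n, hrank (a - 1), hn, hw1, hlk, hlk, auxP_append M x, auxP_append M x]
    change ((_ + (_ + auxP M (M.eval x) _ 0) : ℕ) : ZMod p)
      = ((_ + (_ + auxP M (M.eval x) _ 0) : ℕ) : ZMod p)
    rw [auxP_pow M y z _ hMy, auxP_pow M y z _ hMy]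
    have e1 : ((∑ i ∈ Finset.range (x.length + ((1 + T * p) * y.length + z.length)),
        uCount M M.start i : ℕ) : ZMod p) =
        ((∑ i ∈ Finset.range (x.length + (1 * y.length + z.length)),
        uCount M M.start i : ℕ) : ZMod p) := by
      have := aux_sum_block p T (x.length + (1 * y.length + z.length))
        (fun i => (uCount M M.start i : ZMod p)) (fun i k hi => hTper _ _ _ (by omega)) y.length
      rw [show x.length + ((1 + T * p) * y.length + z.length) =
        x.length + (1 * y.length + z.length) + T * (p * y.length) by ring]
      push_cast
      exact this
    have e2 : (auxP M M.start x
        (((List.replicate (1 + T * p) y).flatten ++ z).length + 0) : ZMod p) =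
        auxP M M.start x (((List.replicate 1 y).flatten ++ z).length + 0) := by
      rw [show ((List.replicate (1 + T * p) y).flatten ++ z).length + 0 =
        ((List.replicate 1 y).flatten ++ z).length + 0 + T * (p * y.length) by
          simp; ring]
      exact auxP_per M p T I hTper x _ _ _ (by simp; omega)
    have e3 : ((∑ c ∈ Finset.range (1 + T * p),
        auxP M (M.eval x) y (z.length + c * y.length) : ℕ) : ZMod p) =
        ((∑ c ∈ Finset.range 1,
        auxP M (M.eval x) y (z.length + c * y.length) : ℕ) : ZMod p) := by
      have := aux_sum_block p T 1
        (fun c => (auxP M (M.eval x) y (z.length + c * y.length) : ZMod p))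
        (fun c k _ => by
          rw [show z.length + (c + T * k) * y.length =
            z.length + c * y.length + T * (k * y.length) by ring]
          exact auxP_per M p T I hTper y _ _ _ (by nlinarith [Nat.zero_le (c * y.length)])) 1
      rw [mul_one] at this
      rw [Nat.cast_sum, Nat.cast_sum]
      exact this
    rw [Nat.cast_add, Nat.cast_add, Nat.cast_add, e1, e2, Nat.cast_add, e3]
    simp only [Nat.cast_add]
  obtain ⟨c, hc⟩ : p ∣ n - (a - 1) :=
    (Nat.modEq_iff_dvd' hlt.le).mp ((ZMod.natCast_eq_natCast_iff _ _ _).mp hcong.symm)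
  have hiter : ∀ k, (a - 1 + p ∈ X ↔ a - 1 + p + p * k ∈ X) := by
    intro k
    induction k with
    | zero => simp
    | succ k ih =>
      rw [ih, Nat.mul_succ, ← add_assoc]
      exact hper _ (by
        have := Nat.zero_le (p * k)
        omega)
  have hfin : IsPeriodPair X (a - 1) p := by
    refine ⟨hp, fun m hm => ?_⟩
    rcases hm.lt_or_eq with h | h
    · exact hper m (by omega)
    · subst h
      cases c with
      | zero => simp at hc; omega
      | succ c =>
        rw [hXn, hiter c]
        rw [Nat.mul_succ] at hc
        rw [show n = a - 1 + p + p * c by omega]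
  have := hle _ hfin
  omega
end
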